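/- arXiv:1506.05239 — 6 statements merged into one kernel-verified Lean document; each statement's English description precedes it below -/
import Mathlib

section
/- Let n ≥ 1, let C₀, m, ε > 0, and let (p_t)_{t>0} be measurable kernels on ℝⁿ × ℝⁿ satisfying |p_t(x,y)| ≤ C₀ t^{-n/m} (1 + |x−y| t^{-1/m})^{-(n+ε)} for all t > 0 and x, y ∈ ℝⁿ, together with the Chapman–Kolmogorov identity ∫_{ℝⁿ} p_t(x,z) p_s(z,y) dz = p_{t+s}(x,y) for all s, t > 0 and almost every (x,y). Let 1 ≤ p < ∞, 0 < λ < n, let β ∈ (0, ε), and let f be of type (p;β) with ‖f‖_{𝓛_L^{p,λ}} < ∞. Then for every δ > 0 there is a constant C(δ) > 0, independent of f and t, such that for all t > 0, ∫_{ℝⁿ} |T_t f(x) − f(x)|^p (t^{1/m} + |x|)^{-(n+δ)} dx ≤ C(δ) t^{-(n−λ+δ)/m} ‖f‖_{𝓛_L^{p,λ}}^p. -/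
open MeasureTheory Metric Filter Topology

open scoped ENNReal

/-- A function whose integrals over all balls of radius `r` are at most `A` has, against a weight
that is comparable at scale `r`, a weighted integral controlled by that of the weight. -/
theorem measure_ball_mul_lintegral_mul_le {E : Type*} [NormedAddCommGroup E] [MeasurableSpace E]
    [BorelSpace E] [SecondCountableTopology E] (μ : Measure E) [SFinite μ]
    [μ.IsAddLeftInvariant] {g w : E → ℝ≥0∞} (hg : Measurable g)
    (hw : Measurable w) {r : ℝ} {A c : ℝ≥0∞} (hA : ∀ y, ∫⁻ x in ball y r, g x ∂μ ≤ A)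
    (hc : ∀ x y, dist x y < r → w x ≤ c * w y) :
    μ (ball 0 r) * ∫⁻ x, g x * w x ∂μ ≤ c * A * ∫⁻ y, w y ∂μ := by
  have hD : MeasurableSet {q : E × E | dist q.1 q.2 < r} :=
    measurableSet_lt (by fun_prop) measurable_const
  have hF : Measurable ({q : E × E | dist q.1 q.2 < r}.indicator
      fun q => g q.1 * (c * w q.2)) :=
    Measurable.indicator (by fun_prop) hD
  calc μ (ball 0 r) * ∫⁻ x, g x * w x ∂μ
      = ∫⁻ x, ∫⁻ _ in ball x r, g x * w x ∂μ ∂μ := by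
        rw [← lintegral_const_mul _ (by fun_prop)]
        refine lintegral_congr fun x => ?_
        have hball : μ (ball x r) = μ (ball 0 r) := by
          simpa [preimage_add_ball] using measure_preimage_add μ (-x) (ball 0 r)
        rw [setLIntegral_const, mul_comm, hball]
    _ ≤ ∫⁻ x, ∫⁻ y, {q : E × E | dist q.1 q.2 < r}.indicator
          (fun q => g q.1 * (c * w q.2)) (x, y) ∂μ ∂μ := by
        refine lintegral_mono fun x => ?_
        rw [← lintegral_indicator measurableSet_ball]
        refine lintegral_mono fun y => ?_
        by_cases h : dist x y < r
        · rw [Set.indicator_of_mem (by rwa [mem_ball']),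
            Set.indicator_of_mem (by exact h)]
          exact mul_le_mul_right (hc x y h) _
        · rw [Set.indicator_of_notMem (by rwa [mem_ball'])]
          exact zero_le
    _ = ∫⁻ y, ∫⁻ x, {q : E × E | dist q.1 q.2 < r}.indicator
          (fun q => g q.1 * (c * w q.2)) (x, y) ∂μ ∂μ :=
        lintegral_lintegral_swap hF.aemeasurable
    _ = ∫⁻ y, (∫⁻ x in ball y r, g x ∂μ) * (c * w y) ∂μ := by
        refine lintegral_congr fun y => ?_
        rw [← lintegral_mul_const _ hg, ← lintegral_indicator measurableSet_ball]
        rfl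
    _ ≤ ∫⁻ y, A * (c * w y) ∂μ :=
        lintegral_mono fun y => mul_le_mul_left (hA y) _
    _ = c * A * ∫⁻ y, w y ∂μ := by
        rw [← lintegral_const_mul _ hw]
        exact lintegral_congr fun y => by ring

/-- Rescaling of the weight `(r + ‖x‖) ^ (-s)` to unit scale. -/
theorem add_norm_rpow_neg_eq {E : Type*} [NormedAddCommGroup E] [NormedSpace ℝ E] {r : ℝ}
    (hr : 0 < r) (s : ℝ) (x : E) :
    (r + ‖x‖) ^ (-s) = r ^ (-s) * (1 + ‖r⁻¹ • x‖) ^ (-s) := by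
  rw [← Real.mul_rpow hr.le (by positivity), norm_smul, Real.norm_of_nonneg (by positivity)]
  congr 1
  field_simp

/-- The weight `(r + ‖x‖) ^ (-s)` varies by at most a factor `2 ^ s` at scale `r`. -/
theorem add_norm_rpow_neg_le {E : Type*} [NormedAddCommGroup E] {r s : ℝ} (hr : 0 < r)
    (hs : 0 ≤ s) {x y : E} (hxy : dist x y < r) :
    (r + ‖x‖) ^ (-s) ≤ 2 ^ s * (r + ‖y‖) ^ (-s) := by
  have hy : (0 : ℝ) < r + ‖y‖ := by positivity
  have hx : ‖y‖ ≤ ‖x‖ + dist x y := by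
    rw [dist_comm, dist_eq_norm]
    linarith [norm_sub_norm_le y x]
  have h : (r + ‖y‖) / 2 ≤ r + ‖x‖ := by linarith [norm_nonneg x]
  calc (r + ‖x‖) ^ (-s) ≤ ((r + ‖y‖) / 2) ^ (-s) :=
        Real.rpow_le_rpow_of_nonpos (by positivity) h (by linarith)
    _ = 2 ^ s * (r + ‖y‖) ^ (-s) := by
        rw [Real.div_rpow hy.le (by norm_num), Real.rpow_neg (by norm_num : (0 : ℝ) ≤ 2),
          div_inv_eq_mul, mul_comm]

/-- The weighted form, at the weight `(r + ‖x‖) ^ (-(d + δ))`, of a Morrey-type bound on all balls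
of radius `r`, where `d` is the dimension. -/
theorem integrable_and_integral_mul_add_norm_rpow_le {E : Type*} [NormedAddCommGroup E]
    [NormedSpace ℝ E] [FiniteDimensional ℝ E] [MeasurableSpace E] [BorelSpace E]
    (μ : Measure E) [μ.IsAddHaarMeasure] {d : ℕ} (hd : Module.finrank ℝ E = d) {δ : ℝ}
    (hδ : 0 < δ) {g : E → ℝ} (hg : Measurable g) (hg0 : ∀ x, 0 ≤ g x) {r A : ℝ} (hr : 0 < r)
    (hA0 : 0 ≤ A) (hgi : ∀ y, IntegrableOn g (ball y r) μ)
    (hA : ∀ y, ∫ x in ball y r, g x ∂μ ≤ A) :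
    Integrable (fun x => g x * (r + ‖x‖) ^ (-((d : ℝ) + δ))) μ ∧
      ∫ x, g x * (r + ‖x‖) ^ (-((d : ℝ) + δ)) ∂μ ≤
        2 ^ ((d : ℝ) + δ) * (μ.real (ball 0 1))⁻¹ *
          (∫ x, (1 + ‖x‖) ^ (-((d : ℝ) + δ)) ∂μ) * r ^ (-((d : ℝ) + δ)) * A := by
  set s : ℝ := (d : ℝ) + δ with hs
  have hs0 : 0 ≤ s := by positivity
  have hw0 : ∀ x : E, 0 ≤ (r + ‖x‖) ^ (-s) := fun x => by positivity
  have hwm : Measurable fun x : E => (r + ‖x‖) ^ (-s) := by fun_prop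
  have h1 : Integrable (fun x : E => (1 + ‖x‖) ^ (-s)) μ :=
    integrable_one_add_norm (by rw [hd]; linarith)
  have hwi : Integrable (fun x : E => (r + ‖x‖) ^ (-s)) μ := by
    simp_rw [add_norm_rpow_neg_eq hr s]
    exact (h1.comp_smul (inv_ne_zero hr.ne')).const_mul _
  have hwint : ∫ x, (r + ‖x‖) ^ (-s) ∂μ =
      r ^ (-s) * (r ^ d * ∫ x, (1 + ‖x‖) ^ (-s) ∂μ) := by
    simp_rw [add_norm_rpow_neg_eq hr s]
    rw [integral_const_mul, Measure.integral_comp_smul μ (fun x : E => (1 + ‖x‖) ^ (-s)), hd]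
    simp [abs_of_pos hr]
  have hV : 0 < μ.real (ball (0 : E) 1) :=
    ENNReal.toReal_pos (measure_ball_pos μ 0 one_pos).ne' measure_ball_lt_top.ne
  have hVr : μ (ball (0 : E) r) = ENNReal.ofReal (r ^ d * μ.real (ball (0 : E) 1)) := by
    rw [Measure.addHaar_ball_of_pos μ 0 hr, hd, ENNReal.ofReal_mul (by positivity),
      ofReal_measureReal measure_ball_lt_top.ne]
  have key := measure_ball_mul_lintegral_mul_le μ (g := fun x => ENNReal.ofReal (g x))
    (w := fun x => ENNReal.ofReal ((r + ‖x‖) ^ (-s))) (r := r) (A := ENNReal.ofReal A)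
    (c := ENNReal.ofReal (2 ^ s)) hg.ennreal_ofReal hwm.ennreal_ofReal
    (fun y => by
      rw [← ofReal_integral_eq_lintegral_ofReal (hgi y) (ae_of_all _ hg0)]
      exact ENNReal.ofReal_le_ofReal (hA y))
    (fun x y hxy => by
      rw [← ENNReal.ofReal_mul (by positivity)]
      exact ENNReal.ofReal_le_ofReal (add_norm_rpow_neg_le hr hs0 hxy))
  simp_rw [← ENNReal.ofReal_mul (hg0 _)] at key
  rw [← ofReal_integral_eq_lintegral_ofReal hwi (ae_of_all _ hw0), hVr,
    ← ENNReal.ofReal_mul (by positivity), ← ENNReal.ofReal_mul (by positivity)] at key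
  have hint : Integrable (fun x => g x * (r + ‖x‖) ^ (-s)) μ := by
    refine ⟨(hg.mul hwm).aestronglyMeasurable, ?_⟩
    rw [hasFiniteIntegral_iff_ofReal (ae_of_all _ fun x => mul_nonneg (hg0 x) (hw0 x))]
    refine lt_top_iff_ne_top.2 fun htop => ?_
    rw [htop, ENNReal.mul_top (by positivity)] at key
    exact ENNReal.ofReal_ne_top (top_le_iff.1 key)
  refine ⟨hint, ?_⟩
  rw [← ofReal_integral_eq_lintegral_ofReal hint
      (ae_of_all _ fun x => mul_nonneg (hg0 x) (hw0 x)),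
    ← ENNReal.ofReal_mul (by positivity),
    ENNReal.ofReal_le_ofReal_iff (mul_nonneg (by positivity) (integral_nonneg hw0)),
    hwint] at key
  have hrd : 0 < r ^ d * μ.real (ball (0 : E) 1) := by positivity
  rw [mul_comm, ← le_div_iff₀ hrd] at key
  refine key.trans_eq ?_
  field_simp

/-- for `f` of type `(p;β)` with finite Campanato seminorm, for every `δ > 0`,
`∫_{ℝⁿ} |T_t f(x) - f(x)|^p (t^{1/m} + |x|)^{-(n+δ)} dx ≤ C(δ) t^{-(n-λ+δ)/m} ‖f‖_{𝓛_L^{p,λ}}^p`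
with `C(δ)` independent of `f` and `t`. -/
theorem campanato_weighted_difference_bound
    (n : ℕ) (hn : 1 ≤ n) (C₀ m ε : ℝ) (hC₀ : 0 < C₀) (hm : 0 < m) (hε : 0 < ε)
    (K : ℝ → EuclideanSpace ℝ (Fin n) → EuclideanSpace ℝ (Fin n) → ℝ)
    (hKmeas : ∀ t : ℝ, 0 < t → Measurable (Function.uncurry (K t)))
    (hK : ∀ t : ℝ, 0 < t → ∀ x y : EuclideanSpace ℝ (Fin n),
      |K t x y| ≤ C₀ * t ^ (-(n : ℝ) / m) *
        (1 + ‖x - y‖ * t ^ (-(1 : ℝ) / m)) ^ (-((n : ℝ) + ε)))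
    (hCK : ∀ t s : ℝ, 0 < t → 0 < s →
      ∀ᵐ xy : EuclideanSpace ℝ (Fin n) × EuclideanSpace ℝ (Fin n) ∂volume,
        (∫ z, K t xy.1 z * K s z xy.2) = K (t + s) xy.1 xy.2)
    (p lam β : ℝ) (hp : 1 ≤ p) (hlam0 : 0 < lam) (hlamn : lam < n)
    (hβ0 : 0 < β) (hβε : β < ε) :
    ∀ δ : ℝ, 0 < δ → ∃ C : ℝ, 0 < C ∧
      ∀ (f : EuclideanSpace ℝ (Fin n) → ℂ) (N : ℝ), Measurable f → 0 ≤ N →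
        Integrable (fun x => ‖f x‖ ^ p * (1 + ‖x‖) ^ (-((n : ℝ) + β))) →
        (∀ (xB : EuclideanSpace ℝ (Fin n)) (rB : ℝ), 0 < rB →
          IntegrableOn
            (fun x => ‖f x - ∫ y, K (rB ^ m) x y • f y‖ ^ p) (ball xB rB)) →
        (∀ (xB : EuclideanSpace ℝ (Fin n)) (rB : ℝ), 0 < rB →
          (∫ x in ball xB rB, ‖f x - ∫ y, K (rB ^ m) x y • f y‖ ^ p) ≤
            N ^ p * rB ^ lam) →
        ∀ (t : ℝ), 0 < t →
          Integrable (fun x => ‖(∫ y, K t x y • f y) - f x‖ ^ p *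
            (t ^ ((1 : ℝ) / m) + ‖x‖) ^ (-((n : ℝ) + δ))) ∧
          (∫ x, ‖(∫ y, K t x y • f y) - f x‖ ^ p *
              (t ^ ((1 : ℝ) / m) + ‖x‖) ^ (-((n : ℝ) + δ))) ≤
            C * t ^ (-((n : ℝ) - lam + δ) / m) * N ^ p := by
  intro δ hδ
  let J : ℝ := ∫ x : EuclideanSpace ℝ (Fin n), (1 + ‖x‖) ^ (-((n : ℝ) + δ))
  let C : ℝ := 2 ^ ((n : ℝ) + δ) *
    (volume.real (ball (0 : EuclideanSpace ℝ (Fin n)) 1))⁻¹ * J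
  have hJ : 0 ≤ J := integral_nonneg fun x => by positivity
  have hC : 0 ≤ C := by positivity
  refine ⟨C + 1, by positivity, fun f N hf hN _ hfi hfN t ht => ?_⟩
  set r : ℝ := t ^ ((1 : ℝ) / m) with hr
  have hr0 : 0 < r := by positivity
  have hrm : r ^ m = t := by
    rw [hr, ← Real.rpow_mul ht.le, one_div_mul_cancel hm.ne', Real.rpow_one]
  have hTm : Measurable fun x => ∫ y, K t x y • f y := by
    have hKf : Measurable fun q : EuclideanSpace ℝ (Fin n) × EuclideanSpace ℝ (Fin n) =>
        K t q.1 q.2 • f q.2 := (hKmeas t ht).smul (hf.comp measurable_snd)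
    exact (hKf.stronglyMeasurable.integral_prod_right (ν := volume)).measurable
  have hgm : Measurable fun x => ‖(∫ y, K t x y • f y) - f x‖ ^ p :=
    ((hTm.sub hf).norm).pow_const p
  obtain ⟨hint, hle⟩ := integrable_and_integral_mul_add_norm_rpow_le volume
    (finrank_euclideanSpace_fin (𝕜 := ℝ) (n := n)) hδ hgm (fun x => by positivity) hr0
    (A := N ^ p * r ^ lam) (by positivity)
    (fun y => by simpa only [hrm, norm_sub_rev (f _)] using hfi y r hr0)
    (fun y => by simpa only [hrm, norm_sub_rev (f _)] using hfN y r hr0)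
  refine ⟨hint, hle.trans ?_⟩
  have hpow : t ^ (-((n : ℝ) - lam + δ) / m) = r ^ (-((n : ℝ) + δ)) * r ^ lam := by
    rw [← Real.rpow_add hr0, hr, ← Real.rpow_mul ht.le]
    congr 1
    ring
  rw [hpow]
  calc C * r ^ (-((n : ℝ) + δ)) * (N ^ p * r ^ lam)
      = C * (r ^ (-((n : ℝ) + δ)) * r ^ lam) * N ^ p := by ring
    _ ≤ (C + 1) * (r ^ (-((n : ℝ) + δ)) * r ^ lam) * N ^ p := by
      gcongr
      linarith
end

section
/- Let n ≥ 1, let C₀, m, ε > 0, and let (p_t)_{t>0} be measurable kernels on ℝⁿ × ℝⁿ satisfying |p_t(x,y)| ≤ C₀ t^{-n/m} (1 + |x−y| t^{-1/m})^{-(n+ε)} for all t > 0 and x, y ∈ ℝⁿ, together with the Chapman–Kolmogorov identity ∫_{ℝⁿ} p_t(x,z) p_s(z,y) dz = p_{t+s}(x,y) for all s, t > 0 and almost every (x,y). Let 1 ≤ p < ∞, 0 < λ < n, let β ∈ (0, ε), and let f be of type (p;β) with ‖f‖_{𝓛_L^{p,λ}} < ∞, and let g be a function with sup_{x ∈ ℝⁿ}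 |T_t f(x) − g(x)| → 0 as t → +∞. Then g is itself of type (p;β), i.e. ∫_{ℝⁿ} |g(x)|^p (1+|x|)^{-(n+β)} dx < ∞. -/
open MeasureTheory Metric Filter Topology

/-- The weight `(1 + ‖x‖) ^ (-s)`, valued in `ℝ≥0∞`. -/
noncomputable def decayWeight {n : ℕ} (s : ℝ) (x : EuclideanSpace ℝ (Fin n)) : ENNReal :=
  ENNReal.ofReal ((1 + ‖x‖) ^ (-s))

theorem measurable_decayWeight {n : ℕ} (s : ℝ) :
    Measurable (decayWeight (n := n) s) := by
  unfold decayWeight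
  fun_prop

theorem lintegral_decayWeight_lt_top {n : ℕ} {s : ℝ} (hs : (n : ℝ) < s) :
    ∫⁻ x : EuclideanSpace ℝ (Fin n), decayWeight s x < ⊤ :=
  finite_integral_one_add_norm (by simpa using hs)

theorem decayWeight_sub_mul_le {n : ℕ} {s : ℝ} (hs : 0 ≤ s)
    (x y : EuclideanSpace ℝ (Fin n)) :
    decayWeight s (x - y) * decayWeight s x ≤
      ENNReal.ofReal (2 ^ s) * decayWeight s y * (decayWeight s (x - y) + decayWeight s x) := by
  have key : ∀ b : ℝ, (1 + ‖y‖) / 2 ≤ b →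
      b ^ (-s) ≤ 2 ^ s * (1 + ‖y‖) ^ (-s) := by
    intro b hb
    have h0 : 0 < (1 + ‖y‖) / 2 := by positivity
    refine (Real.rpow_le_rpow_of_nonpos h0 hb (by linarith)).trans_eq ?_
    rw [Real.div_rpow (by positivity) (by norm_num), Real.rpow_neg (by norm_num : (0 : ℝ) ≤ 2)]
    field_simp
  have keyE : ∀ z : EuclideanSpace ℝ (Fin n), (1 + ‖y‖) / 2 ≤ 1 + ‖z‖ →
      decayWeight s z ≤ ENNReal.ofReal (2 ^ s) * decayWeight s y := by
    intro z hz
    unfold decayWeight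
    rw [← ENNReal.ofReal_mul (by positivity)]
    exact ENNReal.ofReal_le_ofReal (key _ hz)
  have htri : ‖y‖ ≤ ‖x‖ + ‖x - y‖ := by
    have := norm_sub_le x (x - y)
    simpa using this
  rcases le_total ‖x‖ ‖x - y‖ with h | h
  · calc _ ≤ ENNReal.ofReal (2 ^ s) * decayWeight s y * decayWeight s x := by
          gcongr
          exact keyE _ (by linarith [norm_nonneg x])
      _ ≤ _ := by gcongr; exact le_add_self
  · calc _ = decayWeight s x * decayWeight s (x - y) := mul_comm _ _
      _ ≤ ENNReal.ofReal (2 ^ s) * decayWeight s y * decayWeight s (x - y) := by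
          gcongr
          exact keyE _ (by linarith [norm_nonneg (x - y)])
      _ ≤ _ := by gcongr; exact le_self_add

/-- The decay weight is almost reproduced by convolution with itself. -/
theorem lintegral_decayWeight_sub_mul_le {n : ℕ} {s : ℝ} (hs : 0 ≤ s)
    (y : EuclideanSpace ℝ (Fin n)) :
    ∫⁻ x, decayWeight s (x - y) * decayWeight s x ≤
      ENNReal.ofReal (2 ^ s) * decayWeight s y *
        (2 * ∫⁻ x : EuclideanSpace ℝ (Fin n), decayWeight s x) := by
  have hW := measurable_decayWeight (n := n) s
  calc _ ≤ ∫⁻ x, ENNReal.ofReal (2 ^ s) * decayWeight s y *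
        (decayWeight s (x - y) + decayWeight s x) :=
        lintegral_mono fun x => decayWeight_sub_mul_le hs x y
    _ = _ := by
        rw [lintegral_const_mul _ (by fun_prop), lintegral_add_right _ hW,
          lintegral_sub_right_eq_self (decayWeight s) y, two_mul]

theorem lintegral_enorm_rpow_le {α E : Type*} [MeasurableSpace α] [NormedAddCommGroup E]
    {μ : Measure α} {f : α → E} (hf : AEStronglyMeasurable f μ) {p : ℝ} (hp : 1 ≤ p) :
    (∫⁻ x, ‖f x‖ₑ ∂μ) ^ p ≤ (∫⁻ x, ‖f x‖ₑ ^ p ∂μ) * μ Set.univ ^ (p - 1) := by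
  have hp0 : 0 < p := by linarith
  have h := ENNReal.rpow_le_rpow
    (eLpNorm'_le_eLpNorm'_mul_rpow_measure_univ one_pos hp hf) hp0.le
  rw [ENNReal.mul_rpow_of_nonneg _ _ hp0.le, ← ENNReal.rpow_mul] at h
  simp only [eLpNorm', ENNReal.rpow_one, div_one, ← ENNReal.rpow_mul] at h
  rwa [one_div_mul_cancel hp0.ne', ENNReal.rpow_one,
    show (1 - 1 / p) * p = p - 1 by field_simp] at h

/-- Convolution with the decay weight preserves the space of functions of type `(p;β)`. -/
theorem lintegral_convolution_decayWeight_lt_top {n : ℕ} {s p : ℝ} (hs : (n : ℝ) < s)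
    (hp : 1 ≤ p) {f : EuclideanSpace ℝ (Fin n) → ℂ} (hf : Measurable f)
    (hfin : ∫⁻ y, ‖f y‖ₑ ^ p * decayWeight s y < ⊤) :
    ∫⁻ x, (∫⁻ y, decayWeight s (x - y) * ‖f y‖ₑ) ^ p * decayWeight s x < ⊤ := by
  have hs0 : 0 ≤ s := n.cast_nonneg.trans hs.le
  have hW := measurable_decayWeight (n := n) s
  set I := ∫⁻ x : EuclideanSpace ℝ (Fin n), decayWeight s x
  have hItop : I < ⊤ := lintegral_decayWeight_lt_top hs
  have holder : ∀ x, (∫⁻ y, decayWeight s (x - y) * ‖f y‖ₑ) ^ p ≤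
      (∫⁻ y, decayWeight s (x - y) * ‖f y‖ₑ ^ p) * I ^ (p - 1) := by
    intro x
    have hk : Measurable fun y => decayWeight s (x - y) := by fun_prop
    have h := lintegral_enorm_rpow_le
      (μ := volume.withDensity fun y => decayWeight s (x - y)) hf.aestronglyMeasurable hp
    rw [lintegral_withDensity_eq_lintegral_mul _ hk (by fun_prop),
      lintegral_withDensity_eq_lintegral_mul _ hk (by fun_prop),
      withDensity_apply _ MeasurableSet.univ, setLIntegral_univ,
      lintegral_sub_left_eq_self (decayWeight s) x] at h
    exact h
  calc _ ≤ ∫⁻ x, I ^ (p - 1) *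
        ∫⁻ y, ‖f y‖ₑ ^ p * (decayWeight s (x - y) * decayWeight s x) := by
        refine lintegral_mono fun x => ?_
        calc _ ≤ (∫⁻ y, decayWeight s (x - y) * ‖f y‖ₑ ^ p) * I ^ (p - 1) * decayWeight s x := by
              gcongr; exact holder x
          _ = I ^ (p - 1) * ((∫⁻ y, decayWeight s (x - y) * ‖f y‖ₑ ^ p) * decayWeight s x) := by
              ring
          _ = _ := by
              rw [← lintegral_mul_const _ (by fun_prop)]
              congr 1
              refine lintegral_congr fun y => ?_
              ring
    _ = I ^ (p - 1) *
        ∫⁻ y, ‖f y‖ₑ ^ p * ∫⁻ x, decayWeight s (x - y) * decayWeight s x := by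
        rw [lintegral_const_mul' _ _ (ENNReal.rpow_ne_top_of_nonneg (by linarith) hItop.ne),
          lintegral_lintegral_swap (by fun_prop)]
        congr 1
        refine lintegral_congr fun y => ?_
        rw [lintegral_const_mul _ (by fun_prop)]
    _ ≤ I ^ (p - 1) * ∫⁻ y, ENNReal.ofReal (2 ^ s) * (2 * I) * (‖f y‖ₑ ^ p * decayWeight s y) := by
        refine mul_le_mul_right (lintegral_mono fun y => ?_) _
        calc _ ≤ ‖f y‖ₑ ^ p * (ENNReal.ofReal (2 ^ s) * decayWeight s y * (2 * I)) := by
              gcongr; exact lintegral_decayWeight_sub_mul_le hs0 y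
          _ = _ := by ring
    _ < ⊤ := by
        rw [lintegral_const_mul _ (by fun_prop)]
        exact ENNReal.mul_lt_top (ENNReal.rpow_lt_top_of_nonneg (by linarith) hItop.ne)
          (ENNReal.mul_lt_top (ENNReal.mul_lt_top ENNReal.ofReal_lt_top
            (ENNReal.mul_lt_top (by simp) hItop)) hfin)

/-- A dilated decay profile is dominated by a multiple of a slower undilated one. -/
theorem one_add_mul_rpow_neg_le {r c s s' : ℝ} (hr : 0 ≤ r) (hc : 0 < c) (hs : 0 ≤ s)
    (hss : s ≤ s') :
    (1 + r * c) ^ (-s') ≤ (min 1 c) ^ (-s) * (1 + r) ^ (-s) := by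
  have hmin : 0 < min 1 c := lt_min one_pos hc
  rw [← Real.mul_rpow hmin.le (by positivity)]
  have h1 : (1 : ℝ) ≤ 1 + r * c := by nlinarith [mul_nonneg hr hc.le]
  refine (Real.rpow_le_rpow_of_exponent_le h1 (neg_le_neg hss)).trans ?_
  refine Real.rpow_le_rpow_of_nonpos (by positivity) ?_ (by linarith)
  nlinarith [min_le_left 1 c, mul_le_mul_of_nonneg_left (min_le_right 1 c) hr]

theorem enorm_rpow_mul_decayWeight {n : ℕ} {s p : ℝ} (hp : 0 ≤ p) (z : ℂ)
    (x : EuclideanSpace ℝ (Fin n)) :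
    ‖‖z‖ ^ p * (1 + ‖x‖) ^ (-s)‖ₑ = ‖z‖ₑ ^ p * decayWeight s x := by
  rw [Real.enorm_of_nonneg (by positivity), ENNReal.ofReal_mul (by positivity), decayWeight,
    ← ENNReal.ofReal_rpow_of_nonneg (norm_nonneg z) hp, ofReal_norm]

/-- if `f` is of type `(p;β)` with finite Campanato seminorm and `T_t f → g`
uniformly on `ℝⁿ` as `t → ∞`, then the limit function `g` is itself of type `(p;β)`, i.e.
`∫_{ℝⁿ} |g(x)|^p (1+|x|)^{-(n+β)} dx < ∞`. -/
theorem campanato_limit_is_of_type_p_beta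
    (n : ℕ) (hn : 1 ≤ n) (C₀ m ε : ℝ) (hC₀ : 0 < C₀) (hm : 0 < m) (hε : 0 < ε)
    (K : ℝ → EuclideanSpace ℝ (Fin n) → EuclideanSpace ℝ (Fin n) → ℝ)
    (hKmeas : ∀ t : ℝ, 0 < t → Measurable (Function.uncurry (K t)))
    (hK : ∀ t : ℝ, 0 < t → ∀ x y : EuclideanSpace ℝ (Fin n),
      |K t x y| ≤ C₀ * t ^ (-(n : ℝ) / m) *
        (1 + ‖x - y‖ * t ^ (-(1 : ℝ) / m)) ^ (-((n : ℝ) + ε)))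
    (hCK : ∀ t s : ℝ, 0 < t → 0 < s →
      ∀ᵐ xy : EuclideanSpace ℝ (Fin n) × EuclideanSpace ℝ (Fin n) ∂volume,
        (∫ z, K t xy.1 z * K s z xy.2) = K (t + s) xy.1 xy.2)
    (p lam β : ℝ) (hp : 1 ≤ p) (hlam0 : 0 < lam) (hlamn : lam < n)
    (hβ0 : 0 < β) (hβε : β < ε)
    (f : EuclideanSpace ℝ (Fin n) → ℂ) (N : ℝ) (hfmeas : Measurable f) (hN : 0 ≤ N)
    (hfβ : Integrable (fun x => ‖f x‖ ^ p * (1 + ‖x‖) ^ (-((n : ℝ) + β))))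
    (hCamInt : ∀ (xB : EuclideanSpace ℝ (Fin n)) (rB : ℝ), 0 < rB →
      IntegrableOn (fun x => ‖f x - ∫ y, K (rB ^ m) x y • f y‖ ^ p) (ball xB rB))
    (hCam : ∀ (xB : EuclideanSpace ℝ (Fin n)) (rB : ℝ), 0 < rB →
      (∫ x in ball xB rB, ‖f x - ∫ y, K (rB ^ m) x y • f y‖ ^ p) ≤ N ^ p * rB ^ lam)
    (g : EuclideanSpace ℝ (Fin n) → ℂ)
    (hg : ∀ η : ℝ, 0 < η → ∃ t₀ : ℝ, ∀ t : ℝ, t₀ ≤ t →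
      ∀ x : EuclideanSpace ℝ (Fin n), ‖(∫ y, K t x y • f y) - g x‖ ≤ η) :
    Integrable (fun x => ‖g x‖ ^ p * (1 + ‖x‖) ^ (-((n : ℝ) + β))) := by
  have hp0 : 0 ≤ p := by linarith
  have hs : (n : ℝ) < n + β := by linarith
  have hs0 : (0 : ℝ) ≤ n + β := by positivity
  have hW := measurable_decayWeight (n := n) (n + β)
  set T : ℝ → EuclideanSpace ℝ (Fin n) → ℂ := fun t x => ∫ y, K t x y • f y
  have hTmeas : ∀ t : ℝ, 0 < t → Measurable (T t) := by
    intro t ht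
    have hm2 : Measurable fun q : EuclideanSpace ℝ (Fin n) × EuclideanSpace ℝ (Fin n) =>
        K t q.1 q.2 • f q.2 := (hKmeas t ht).smul (hfmeas.comp measurable_snd)
    exact (hm2.stronglyMeasurable.integral_prod_right).measurable
  have hgmeas : Measurable g := by
    refine measurable_of_tendsto_metrizable (f := fun k : ℕ => T (k + 1))
      (fun k => hTmeas _ (by positivity)) ?_
    rw [tendsto_pi_nhds]
    intro x
    rw [Metric.tendsto_atTop]
    intro η hη
    obtain ⟨t₀, ht₀⟩ := hg (η / 2) (by positivity)
    obtain ⟨k₀, hk₀⟩ := exists_nat_ge t₀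
    refine ⟨k₀, fun k hk => ?_⟩
    have hk' : (k₀ : ℝ) ≤ k := by exact_mod_cast hk
    rw [dist_eq_norm]
    exact (ht₀ (k + 1) (by linarith) x).trans_lt (by linarith)
  obtain ⟨t₀, ht₀⟩ := hg 1 one_pos
  obtain ⟨t, ht, htg⟩ : ∃ t : ℝ, 0 < t ∧ ∀ x, ‖T t x - g x‖ ≤ 1 :=
    ⟨max t₀ 1, lt_max_of_lt_right one_pos, ht₀ _ (le_max_left _ _)⟩
  obtain ⟨C, hC, hKC⟩ : ∃ C : ℝ, 0 ≤ C ∧ ∀ x y, |K t x y| ≤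
      C * (1 + ‖x - y‖) ^ (-((n : ℝ) + β)) := by
    refine ⟨C₀ * t ^ (-(n : ℝ) / m) * (min 1 (t ^ (-(1 : ℝ) / m))) ^ (-((n : ℝ) + β)),
      by positivity, fun x y => (hK t ht x y).trans ?_⟩
    rw [mul_assoc (C₀ * _)]
    gcongr
    exact one_add_mul_rpow_neg_le (norm_nonneg _) (by positivity) hs0 (by linarith)
  have hTle : ∀ x, ‖T t x‖ₑ ≤
      ENNReal.ofReal C * ∫⁻ y, decayWeight (n + β) (x - y) * ‖f y‖ₑ := by
    intro x
    refine (enorm_integral_le_lintegral_enorm _).trans ?_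
    rw [← lintegral_const_mul _ (by fun_prop)]
    refine lintegral_mono fun y => ?_
    rw [enorm_smul, ← mul_assoc]
    gcongr
    rw [decayWeight, ← ENNReal.ofReal_mul hC, ← ofReal_norm, Real.norm_eq_abs]
    exact ENNReal.ofReal_le_ofReal (hKC x y)
  have hgle : ∀ x, ‖g x‖ₑ ≤ ‖T t x‖ₑ + 1 := by
    intro x
    have h : ‖g x‖ ≤ ‖T t x‖ + 1 := by
      have := norm_sub_le (T t x) (T t x - g x)
      rw [sub_sub_cancel] at this
      linarith [htg x]
    rw [← ofReal_norm, ← ofReal_norm, ← ENNReal.ofReal_one,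
      ← ENNReal.ofReal_add (norm_nonneg _) zero_le_one]
    exact ENNReal.ofReal_le_ofReal h
  have hffin : ∫⁻ y, ‖f y‖ₑ ^ p * decayWeight (n + β) y < ⊤ := by
    have h := hfβ.hasFiniteIntegral
    simpa only [HasFiniteIntegral, enorm_rpow_mul_decayWeight hp0] using h
  have hconv := lintegral_convolution_decayWeight_lt_top hs hp hfmeas hffin
  refine ⟨by fun_prop, ?_⟩
  simp only [HasFiniteIntegral, enorm_rpow_mul_decayWeight hp0]
  calc _ ≤ ∫⁻ x, 2 ^ (p - 1) * (ENNReal.ofReal C ^ p *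
        ((∫⁻ y, decayWeight (n + β) (x - y) * ‖f y‖ₑ) ^ p * decayWeight (n + β) x)
          + decayWeight (n + β) x) := by
        refine lintegral_mono fun x => ?_
        calc _ ≤ (ENNReal.ofReal C * (∫⁻ y, decayWeight (n + β) (x - y) * ‖f y‖ₑ) + 1) ^ p *
              decayWeight (n + β) x := by
              gcongr
              exact (hgle x).trans (by gcongr; exact hTle x)
          _ ≤ (2 ^ (p - 1) * ((ENNReal.ofReal C *
              (∫⁻ y, decayWeight (n + β) (x - y) * ‖f y‖ₑ)) ^ p + 1 ^ p)) *
              decayWeight (n + β) x := by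
              gcongr
              exact ENNReal.rpow_add_le_mul_rpow_add_rpow _ _ hp
          _ = _ := by
              rw [ENNReal.mul_rpow_of_nonneg _ _ hp0, ENNReal.one_rpow]
              ring
    _ < ⊤ := by
        rw [lintegral_const_mul' _ _ (ENNReal.rpow_ne_top_of_nonneg (by linarith) (by simp)),
          lintegral_add_right _ hW,
          lintegral_const_mul' _ _ (ENNReal.rpow_ne_top_of_nonneg hp0 ENNReal.ofReal_ne_top)]
        exact ENNReal.mul_lt_top (ENNReal.rpow_lt_top_of_nonneg (by linarith) (by simp))
          (ENNReal.add_lt_top.2 ⟨ENNReal.mul_lt_top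
            (ENNReal.rpow_lt_top_of_nonneg hp0 ENNReal.ofReal_ne_top) hconv,
            lintegral_decayWeight_lt_top hs⟩)
end

section
/- Let n ≥ 1, let C₀, m, ε > 0, and let (p_t)_{t>0} be measurable kernels on ℝⁿ × ℝⁿ satisfying |p_t(x,y)| ≤ C₀ t^{-n/m} (1 + |x−y| t^{-1/m})^{-(n+ε)} for all t > 0 and x, y ∈ ℝⁿ, together with the Chapman–Kolmogorov identity ∫_{ℝⁿ} p_t(x,z) p_s(z,y) dz = p_{t+s}(x,y) for all s, t > 0 and almost every (x,y). Let 1 ≤ p < ∞, 0 < λ < n, let β ∈ (0, ε), and let f be of type (p;β) with ‖f‖_{𝓛_L^{p,λ}} < ∞, and let g be a function of type (p;β) with sup_{x ∈ ℝⁿ} |T_t f(x) − g(x)| → 0 as t → +∞. Then g is a fixed point of the semigroup: for every s > 0, T_s g(x) = g(x) for almost every x ∈ ℝⁿ. -/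
open MeasureTheory Metric Filter Topology

theorem norm_integral_smul_sub_integral_smul_le {X F : Type*} [MeasurableSpace X]
    {μ : Measure X} [NormedAddCommGroup F] [NormedSpace ℝ F] {η : ℝ} {k : X → ℝ}
    (hk : Integrable k μ)
    {u v : X → F} (hu : AEStronglyMeasurable u μ) (hv : AEStronglyMeasurable v μ)
    (hku : Integrable (fun z => k z • u z) μ) (huv : ∀ z, ‖u z - v z‖ ≤ η) :
    ‖(∫ z, k z • u z ∂μ) - ∫ z, k z • v z ∂μ‖ ≤ η * ∫ z, |k z| ∂μ := by
  have hbound : ∀ z, ‖k z • (u z - v z)‖ ≤ η * |k z| := fun z => by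
    rw [norm_smul, mul_comm, Real.norm_eq_abs]
    exact mul_le_mul_of_nonneg_right (huv z) (abs_nonneg _)
  have hsub : Integrable (fun z => k z • (u z - v z)) μ :=
    (hk.abs.const_mul η).mono' (hk.aestronglyMeasurable.smul (hu.sub hv)) (.of_forall hbound)
  have hkv : Integrable (fun z => k z • v z) μ :=
    (hku.sub hsub).congr (.of_forall fun z => by simp [smul_sub])
  rw [← integral_sub hku hkv, ← integral_const_mul]
  simp_rw [← smul_sub]
  exact norm_integral_le_of_norm_le (hk.abs.const_mul η) (.of_forall hbound)

section PolynomialDecay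

theorem exists_one_add_mul_rpow_neg_le {a q : ℝ} (ha : 0 < a) (hq : 0 ≤ q) :
    ∃ C : ℝ, 0 ≤ C ∧ ∀ r : ℝ, 0 ≤ r → (1 + r * a) ^ (-q) ≤ C * (1 + r) ^ (-q) := by
  have hc : 0 < min 1 a := lt_min one_pos ha
  refine ⟨(min 1 a) ^ (-q), by positivity, fun r hr => ?_⟩
  rw [← Real.mul_rpow hc.le (by positivity)]
  refine Real.rpow_le_rpow_of_nonpos (by positivity) ?_ (neg_nonpos.2 hq)
  have h1 : min 1 a ≤ 1 := min_le_left _ _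
  have h2 : r * min 1 a ≤ r * a := mul_le_mul_of_nonneg_left (min_le_right _ _) hr
  nlinarith

theorem rpow_neg_mul_rpow_neg_le {a b c q : ℝ} (ha : 0 ≤ a) (hb : 0 ≤ b) (hc : 0 ≤ c)
    (hq : 0 ≤ q) (h : c ≤ a + b) :
    (1 + a) ^ (-q) * (1 + b) ^ (-q) ≤
      2 ^ q * (1 + c) ^ (-q) * ((1 + a) ^ (-q) + (1 + b) ^ (-q)) := by
  have key : ∀ d : ℝ, c / 2 ≤ d → (1 + d) ^ (-q) ≤ 2 ^ q * (1 + c) ^ (-q) := fun d hd => by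
    have h2 : (2 : ℝ) ^ q = (1 / 2 : ℝ) ^ (-q) := by
      rw [one_div, Real.inv_rpow zero_le_two, Real.rpow_neg zero_le_two, inv_inv]
    rw [h2, ← Real.mul_rpow (by norm_num) (by positivity)]
    exact Real.rpow_le_rpow_of_nonpos (by positivity) (by linarith) (neg_nonpos.2 hq)
  have hA : 0 ≤ (1 + a) ^ (-q) := by positivity
  have hB : 0 ≤ (1 + b) ^ (-q) := by positivity
  have hC : 0 ≤ 2 ^ q * (1 + c) ^ (-q) := by positivity
  rcases le_total (c / 2) a with h' | h'
  · nlinarith [mul_le_mul_of_nonneg_right (key a h') hB, mul_nonneg hC hA]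
  · nlinarith [mul_le_mul_of_nonneg_left (key b (by linarith)) hA, mul_nonneg hC hB]

variable {E : Type*} [NormedAddCommGroup E]

theorem one_add_norm_sub_rpow_neg_le {q : ℝ} (hq : 0 ≤ q) (x y : E) :
    (1 + ‖x - y‖) ^ (-q) ≤ (1 + ‖x‖) ^ q * (1 + ‖y‖) ^ (-q) := by
  have h : (1 + ‖x‖) ^ q = ((1 + ‖x‖)⁻¹) ^ (-q) := by
    rw [Real.inv_rpow (by positivity), Real.rpow_neg (by positivity), inv_inv]
  rw [h, ← Real.mul_rpow (by positivity) (by positivity)]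
  refine Real.rpow_le_rpow_of_nonpos (by positivity) ?_ (neg_nonpos.2 hq)
  rw [inv_mul_le_iff₀ (by positivity)]
  have : ‖y‖ ≤ ‖x‖ + ‖x - y‖ := by
    simpa using norm_sub_le x (x - y)
  nlinarith [norm_nonneg x, norm_nonneg (x - y)]

variable [NormedSpace ℝ E] [FiniteDimensional ℝ E] [MeasurableSpace E] [BorelSpace E]
  {μ : Measure E} [μ.IsAddHaarMeasure] {F : Type*} [NormedAddCommGroup F]

theorem integrable_one_add_norm_sub_left {q : ℝ} (hq : Module.finrank ℝ E < q) (x : E) :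
    Integrable (fun z => (1 + ‖x - z‖) ^ (-q)) μ :=
  (integrable_one_add_norm (μ := μ) hq).comp_sub_left x

theorem integrable_norm_mul_one_add_norm {p q r : ℝ} (hp : 1 ≤ p)
    (hq : Module.finrank ℝ E < q) (hrq : r ≤ q) {f : E → F} (hf : AEStronglyMeasurable f μ)
    (hfr : Integrable (fun x => ‖f x‖ ^ p * (1 + ‖x‖) ^ (-r)) μ) :
    Integrable (fun x => ‖f x‖ * (1 + ‖x‖) ^ (-q)) μ := by
  have hw := integrable_one_add_norm (μ := μ) hq
  refine (hw.add hfr).mono' (hf.norm.mul hw.aestronglyMeasurable) (.of_forall fun x => ?_)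
  have hle : (1 + ‖x‖) ^ (-q) ≤ (1 + ‖x‖) ^ (-r) :=
    Real.rpow_le_rpow_of_exponent_le (by simp) (by linarith)
  have hw0 : 0 ≤ (1 + ‖x‖) ^ (-q) := by positivity
  have hfp : 0 ≤ ‖f x‖ ^ p := by positivity
  rw [Real.norm_of_nonneg (by positivity), Pi.add_apply]
  rcases le_total ‖f x‖ 1 with h | h
  · nlinarith [mul_le_mul_of_nonneg_right h hw0, mul_nonneg hfp (hw0.trans hle)]
  · have h1 : ‖f x‖ ≤ ‖f x‖ ^ p := Real.self_le_rpow_of_one_le h hp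
    nlinarith [mul_le_mul_of_nonneg_right h1 hw0, mul_le_mul_of_nonneg_left hle hfp]

variable [NormedSpace ℝ F]

theorem integrable_kernel_section {q A : ℝ} (hq : Module.finrank ℝ E < q) {k : E → E → ℝ}
    (hk : Measurable (Function.uncurry k))
    (hkA : ∀ x y, |k x y| ≤ A * (1 + ‖x - y‖) ^ (-q)) (x : E) : Integrable (k x) μ :=
  ((integrable_one_add_norm_sub_left hq x).const_mul A).mono'
    (hk.comp measurable_prodMk_left).aestronglyMeasurable (.of_forall (hkA x))

theorem integrable_prod_kernel_comp {q A B : ℝ} (hA : 0 ≤ A) (hB : 0 ≤ B)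
    (hq : Module.finrank ℝ E < q) {k l : E → E → ℝ}
    (hk : Measurable (Function.uncurry k)) (hl : Measurable (Function.uncurry l))
    (hkA : ∀ x y, |k x y| ≤ A * (1 + ‖x - y‖) ^ (-q))
    (hlB : ∀ x y, |l x y| ≤ B * (1 + ‖x - y‖) ^ (-q))
    {f : E → F} (hf : AEStronglyMeasurable f μ)
    (hfq : Integrable (fun y => ‖f y‖ * (1 + ‖y‖) ^ (-q)) μ) (x : E) :
    Integrable (fun zy : E × E => (k x zy.1 * l zy.1 zy.2) • f zy.2) (μ.prod μ) := by
  have hq0 : 0 ≤ q := (Nat.cast_nonneg _).trans hq.le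
  have hsep := (integrable_one_add_norm_sub_left (μ := μ) hq x).mul_prod hfq
  have hconv := hfq.convolution_integrand (ContinuousLinearMap.mul ℝ ℝ)
    (integrable_one_add_norm (μ := μ) hq)
  have hmeas : Measurable fun zy : E × E => k x zy.1 * l zy.1 zy.2 :=
    (hk.comp (measurable_const.prodMk measurable_fst)).mul hl
  refine ((hsep.add hconv).const_mul (A * B * (2 ^ q * (1 + ‖x‖) ^ q))).mono'
    (hmeas.aestronglyMeasurable.smul hf.comp_snd) (.of_forall fun ⟨z, y⟩ => ?_)
  have h1 : |k x z| * |l z y| ≤ A * B * ((1 + ‖x - z‖) ^ (-q) * (1 + ‖z - y‖) ^ (-q)) :=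
    (mul_le_mul (hkA x z) (hlB z y) (abs_nonneg _) (by positivity)).trans_eq (by ring)
  have h2 := rpow_neg_mul_rpow_neg_le (norm_nonneg (x - z)) (norm_nonneg (z - y))
    (norm_nonneg (x - y)) hq0 (norm_sub_le_norm_sub_add_norm_sub x z y)
  have h3 := one_add_norm_sub_rpow_neg_le hq0 x y
  simp only [norm_smul, Real.norm_eq_abs, abs_mul, Pi.add_apply, ContinuousLinearMap.mul_apply']
  calc |k x z| * |l z y| * ‖f y‖
      ≤ A * B * (2 ^ q * ((1 + ‖x‖) ^ q * (1 + ‖y‖) ^ (-q)) *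
          ((1 + ‖x - z‖) ^ (-q) + (1 + ‖z - y‖) ^ (-q))) * ‖f y‖ := by
        refine mul_le_mul_of_nonneg_right (h1.trans ?_) (norm_nonneg _)
        refine mul_le_mul_of_nonneg_left (h2.trans ?_) (by positivity)
        gcongr
    _ = _ := by ring

theorem ae_integral_kernel_comp [CompleteSpace F] {q A B : ℝ} (hA : 0 ≤ A) (hB : 0 ≤ B)
    (hq : Module.finrank ℝ E < q) {k l j : E → E → ℝ}
    (hk : Measurable (Function.uncurry k)) (hl : Measurable (Function.uncurry l))
    (hkA : ∀ x y, |k x y| ≤ A * (1 + ‖x - y‖) ^ (-q))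
    (hlB : ∀ x y, |l x y| ≤ B * (1 + ‖x - y‖) ^ (-q))
    (hj : ∀ᵐ xy : E × E ∂μ.prod μ, ∫ z, k xy.1 z * l z xy.2 ∂μ = j xy.1 xy.2)
    {f : E → F} (hf : AEStronglyMeasurable f μ)
    (hfq : Integrable (fun y => ‖f y‖ * (1 + ‖y‖) ^ (-q)) μ) :
    ∀ᵐ x ∂μ, ∫ z, k x z • ∫ y, l z y • f y ∂μ ∂μ = ∫ y, j x y • f y ∂μ := by
  filter_upwards [Measure.ae_ae_of_ae_prod hj] with x hx
  have hint := integrable_prod_kernel_comp hA hB hq hk hl hkA hlB hf hfq x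
  calc ∫ z, k x z • ∫ y, l z y • f y ∂μ ∂μ
      = ∫ z, ∫ y, (k x z * l z y) • f y ∂μ ∂μ := by simp_rw [mul_smul, integral_smul]
    _ = ∫ y, ∫ z, (k x z * l z y) • f y ∂μ ∂μ := integral_integral_swap hint
    _ = ∫ y, j x y • f y ∂μ := integral_congr_ae <| hx.mono fun y hy => by
        beta_reduce; rw [integral_smul_const, hy]

theorem integrable_kernel_smul_integral {q A B : ℝ} (hA : 0 ≤ A) (hB : 0 ≤ B)
    (hq : Module.finrank ℝ E < q) {k l : E → E → ℝ}
    (hk : Measurable (Function.uncurry k)) (hl : Measurable (Function.uncurry l))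
    (hkA : ∀ x y, |k x y| ≤ A * (1 + ‖x - y‖) ^ (-q))
    (hlB : ∀ x y, |l x y| ≤ B * (1 + ‖x - y‖) ^ (-q))
    {f : E → F} (hf : AEStronglyMeasurable f μ)
    (hfq : Integrable (fun y => ‖f y‖ * (1 + ‖y‖) ^ (-q)) μ) (x : E) :
    Integrable (fun z => k x z • ∫ y, l z y • f y ∂μ) μ := by
  simpa only [mul_smul, integral_smul] using
    (integrable_prod_kernel_comp hA hB hq hk hl hkA hlB hf hfq x).integral_prod_left

end PolynomialDecay

/-- if `f` is of type `(p;β)` with finite Campanato seminorm and `T_t f → g`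
uniformly as `t → ∞`, where `g` is of type `(p;β)`, then `g` is a fixed point of the
semigroup: `T_s g = g` a.e. for every `s > 0`. -/
theorem campanato_limit_is_semigroup_fixed_point
    (n : ℕ) (hn : 1 ≤ n) (C₀ m ε : ℝ) (hC₀ : 0 < C₀) (hm : 0 < m) (hε : 0 < ε)
    (K : ℝ → EuclideanSpace ℝ (Fin n) → EuclideanSpace ℝ (Fin n) → ℝ)
    (hKmeas : ∀ t : ℝ, 0 < t → Measurable (Function.uncurry (K t)))
    (hK : ∀ t : ℝ, 0 < t → ∀ x y : EuclideanSpace ℝ (Fin n),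
      |K t x y| ≤ C₀ * t ^ (-(n : ℝ) / m) *
        (1 + ‖x - y‖ * t ^ (-(1 : ℝ) / m)) ^ (-((n : ℝ) + ε)))
    (hCK : ∀ t s : ℝ, 0 < t → 0 < s →
      ∀ᵐ xy : EuclideanSpace ℝ (Fin n) × EuclideanSpace ℝ (Fin n) ∂volume,
        (∫ z, K t xy.1 z * K s z xy.2) = K (t + s) xy.1 xy.2)
    (p lam β : ℝ) (hp : 1 ≤ p) (hlam0 : 0 < lam) (hlamn : lam < n)
    (hβ0 : 0 < β) (hβε : β < ε)
    (f : EuclideanSpace ℝ (Fin n) → ℂ) (N : ℝ) (hfmeas : Measurable f) (hN : 0 ≤ N)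
    (hfβ : Integrable (fun x => ‖f x‖ ^ p * (1 + ‖x‖) ^ (-((n : ℝ) + β))))
    (hCamInt : ∀ (xB : EuclideanSpace ℝ (Fin n)) (rB : ℝ), 0 < rB →
      IntegrableOn (fun x => ‖f x - ∫ y, K (rB ^ m) x y • f y‖ ^ p) (ball xB rB))
    (hCam : ∀ (xB : EuclideanSpace ℝ (Fin n)) (rB : ℝ), 0 < rB →
      (∫ x in ball xB rB, ‖f x - ∫ y, K (rB ^ m) x y • f y‖ ^ p) ≤ N ^ p * rB ^ lam)
    (g : EuclideanSpace ℝ (Fin n) → ℂ) (hgmeas : Measurable g)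
    (hgβ : Integrable (fun x => ‖g x‖ ^ p * (1 + ‖x‖) ^ (-((n : ℝ) + β))))
    (hg : ∀ η : ℝ, 0 < η → ∃ t₀ : ℝ, ∀ t : ℝ, t₀ ≤ t →
      ∀ x : EuclideanSpace ℝ (Fin n), ‖(∫ y, K t x y • f y) - g x‖ ≤ η) :
    ∀ s : ℝ, 0 < s →
      ∀ᵐ x : EuclideanSpace ℝ (Fin n) ∂volume, (∫ y, K s x y • g y) = g x := by
  intro s hs
  have hq : (Module.finrank ℝ (EuclideanSpace ℝ (Fin n)) : ℝ) < (n : ℝ) + ε := by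
    simpa using hε
  have hq0 : 0 ≤ (n : ℝ) + ε := by positivity
  have hdecay : ∀ t : ℝ, 0 < t → ∃ A : ℝ, 0 ≤ A ∧
      ∀ x y, |K t x y| ≤ A * (1 + ‖x - y‖) ^ (-((n : ℝ) + ε)) := fun t ht => by
    obtain ⟨C, hC, hCle⟩ := exists_one_add_mul_rpow_neg_le
      (Real.rpow_pos_of_pos ht (-(1 : ℝ) / m)) hq0
    refine ⟨C₀ * t ^ (-(n : ℝ) / m) * C, by positivity, fun x y => (hK t ht x y).trans ?_⟩
    rw [mul_assoc _ C]
    exact mul_le_mul_of_nonneg_left (hCle _ (norm_nonneg _)) (by positivity)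
  have hf := hfmeas.aestronglyMeasurable (μ := volume)
  have hfq := integrable_norm_mul_one_add_norm hp hq (by linarith) hf hfβ
  obtain ⟨A, hA, hKA⟩ := hdecay s hs
  have hcomp : ∀ᵐ x : EuclideanSpace ℝ (Fin n), ∀ k : ℕ,
      (∫ z, K s x z • ∫ y, K (k + 1) z y • f y) = ∫ y, K (s + (k + 1)) x y • f y := by
    refine ae_all_iff.2 fun k => ?_
    have hk : (0 : ℝ) < k + 1 := by positivity
    obtain ⟨B, hB, hKB⟩ := hdecay _ hk
    exact ae_integral_kernel_comp hA hB hq (hKmeas s hs) (hKmeas _ hk) hKA hKB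
      (hCK s _ hs hk) hf hfq
  filter_upwards [hcomp] with x hx
  set M := ∫ z, |K s x z|
  have hM : 0 ≤ M := integral_nonneg fun z => abs_nonneg _
  refine eq_of_forall_dist_le fun δ hδ => ?_
  obtain ⟨t₀, ht₀⟩ := hg (δ / (M + 1)) (by positivity)
  obtain ⟨k, hk⟩ := exists_nat_ge t₀
  have hk0 : (0 : ℝ) < k + 1 := by positivity
  obtain ⟨B, hB, hKB⟩ := hdecay _ hk0
  have hu : AEStronglyMeasurable (fun z => ∫ y, K (k + 1) z y • f y) volume :=
    AEStronglyMeasurable.integral_prod_right'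
      (f := fun zy : EuclideanSpace ℝ (Fin n) × EuclideanSpace ℝ (Fin n) =>
        K (k + 1) zy.1 zy.2 • f zy.2)
      ((hKmeas _ hk0).aestronglyMeasurable.smul hf.comp_snd)
  have h1 := norm_integral_smul_sub_integral_smul_le
    (integrable_kernel_section hq (hKmeas s hs) hKA x) hu hgmeas.aestronglyMeasurable
    (integrable_kernel_smul_integral hA hB hq (hKmeas s hs) (hKmeas _ hk0) hKA hKB hf hfq x)
    (ht₀ (k + 1) (by linarith))
  rw [hx k] at h1
  have h2 := ht₀ (s + (k + 1)) (by linarith) x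
  have h3 : δ / (M + 1) * M + δ / (M + 1) = δ := by field_simp
  rw [← dist_eq_norm] at h1 h2
  linarith [dist_triangle_left (∫ y, K s x y • g y) (g x) (∫ y, K (s + (k + 1)) x y • f y)]
end

section
/- Let n ≥ 1, let C₀, m, ε > 0, and let (p_t)_{t>0} be measurable kernels on ℝⁿ × ℝⁿ satisfying |p_t(x,y)| ≤ C₀ t^{-n/m} (1 + |x−y| t^{-1/m})^{-(n+ε)} for all t > 0 and x, y ∈ ℝⁿ. Let 1 ≤ p < ∞ and 0 < λ < n. If f ∈ L^{p,λ}(ℝⁿ), then for every x ∈ ℝⁿ, T_t f(x) → 0 as t → +∞; in fact sup_{x ∈ ℝⁿ} |T_t f(x)| ≤ C t^{(λ−n)/(pm)} ‖f‖_{L^{p,λ}} → 0, so the limit function σ_L(f) := lim_{t→∞} T_t f vanishes identically. -/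
open MeasureTheory Metric Filter Topology

/-- If the mass of `g` on balls centred at `x` grows at most like `A * r ^ κ`, then its integral
against a radial weight at scale `ρ` decaying to an order `β > κ` is controlled by `A * ρ ^ κ`. -/
theorem exists_lintegral_decay_mul_le {X : Type*} [PseudoMetricSpace X] [MeasurableSpace X]
    [OpensMeasurableSpace X] (μ : Measure X) {κ β : ℝ} (hβ : 0 < β) (hκβ : κ < β) :
    ∃ D : ℝ, 0 < D ∧ ∀ (g : X → ENNReal) (x : X) (A ρ : ℝ), Measurable g → 0 ≤ A → 0 < ρ →
      (∀ r : ℝ, 0 < r → ∫⁻ y in ball x r, g y ∂μ ≤ ENNReal.ofReal (A * r ^ κ)) →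
      ∫⁻ y, ENNReal.ofReal ((1 + dist x y * ρ⁻¹) ^ (-β)) * g y ∂μ
        ≤ ENNReal.ofReal (D * A * ρ ^ κ) := by
  have hq0 : (0 : ℝ) < 2 ^ (κ - β) := by positivity
  have hq1 : (2 : ℝ) ^ (κ - β) < 1 :=
    Real.rpow_lt_one_of_one_lt_of_neg (by norm_num) (by linarith)
  refine ⟨2 ^ κ * (1 - 2 ^ (κ - β))⁻¹,
    mul_pos (by positivity) (inv_pos.2 (by linarith)), ?_⟩
  intro g x A ρ hg hA hρ hball
  have hpt : ∀ y, ENNReal.ofReal ((1 + dist x y * ρ⁻¹) ^ (-β)) * g y ≤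
      ∑' k : ℕ, ENNReal.ofReal (((2 : ℝ) ^ k) ^ (-β)) *
        (ball x (2 ^ (k + 1) * ρ)).indicator g y := by
    intro y
    have hu : 0 ≤ dist x y * ρ⁻¹ := by positivity
    obtain ⟨k, hk1, hk2⟩ := exists_nat_pow_near (x := 1 + dist x y * ρ⁻¹) (y := (2 : ℝ))
      (by linarith) (by norm_num)
    refine le_trans ?_ (ENNReal.le_tsum k)
    have hy : y ∈ ball x (2 ^ (k + 1) * ρ) := by
      rw [mem_ball, dist_comm]
      have h : dist x y * ρ⁻¹ < 2 ^ (k + 1) := by linarith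
      rwa [← div_eq_mul_inv, div_lt_iff₀ hρ] at h
    rw [Set.indicator_of_mem hy]
    gcongr ?_ * _
    exact ENNReal.ofReal_le_ofReal
      (Real.rpow_le_rpow_of_nonpos (by positivity) hk1 (by linarith))
  have hterm : ∀ k : ℕ, ((2 : ℝ) ^ k) ^ (-β) * (A * (2 ^ (k + 1) * ρ) ^ κ) =
      (2 ^ κ * A * ρ ^ κ) * (2 ^ (κ - β)) ^ k := by
    intro k
    rw [Real.mul_rpow (by positivity) hρ.le, pow_succ, Real.mul_rpow (by positivity) (by norm_num),
      sub_eq_add_neg, Real.rpow_add (by norm_num), mul_pow, Real.rpow_pow_comm (by norm_num),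
      Real.rpow_pow_comm (by norm_num)]
    ring
  have hsum := (hasSum_geometric_of_lt_one hq0.le hq1).mul_left (2 ^ κ * A * ρ ^ κ)
  calc ∫⁻ y, ENNReal.ofReal ((1 + dist x y * ρ⁻¹) ^ (-β)) * g y ∂μ
      ≤ ∫⁻ y, ∑' k : ℕ, ENNReal.ofReal (((2 : ℝ) ^ k) ^ (-β)) *
        (ball x (2 ^ (k + 1) * ρ)).indicator g y ∂μ := lintegral_mono hpt
    _ = ∑' k : ℕ, ENNReal.ofReal (((2 : ℝ) ^ k) ^ (-β)) *
        ∫⁻ y in ball x (2 ^ (k + 1) * ρ), g y ∂μ := by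
      rw [lintegral_tsum fun k => ((hg.indicator measurableSet_ball).const_mul _).aemeasurable]
      refine tsum_congr fun k => ?_
      rw [lintegral_const_mul _ (hg.indicator measurableSet_ball),
        lintegral_indicator measurableSet_ball]
    _ ≤ ∑' k : ℕ, ENNReal.ofReal ((2 ^ κ * A * ρ ^ κ) * (2 ^ (κ - β)) ^ k) := by
      refine ENNReal.tsum_le_tsum fun k => ?_
      rw [← hterm k, ENNReal.ofReal_mul (by positivity)]
      gcongr
      exact hball _ (by positivity)
    _ = ENNReal.ofReal (2 ^ κ * (1 - 2 ^ (κ - β))⁻¹ * A * ρ ^ κ) := by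
      rw [← ENNReal.ofReal_tsum_of_nonneg (fun k => by positivity) hsum.summable, hsum.tsum_eq]
      congr 1
      ring

theorem le_add_rpow_mul_rpow {a s p : ℝ} (ha : 0 ≤ a) (hs : 0 < s) (hp : 1 ≤ p) :
    a ≤ s + s ^ (1 - p) * a ^ p := by
  rcases le_or_gt a s with h | h
  · have : 0 ≤ s ^ (1 - p) * a ^ p := by positivity
    linarith
  · have ha' : 0 < a := hs.trans h
    have h1 : a ^ (1 - p) ≤ s ^ (1 - p) :=
      Real.rpow_le_rpow_of_nonpos hs h.le (by linarith)
    have h2 : a = a ^ (1 - p) * a ^ p := by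
      rw [← Real.rpow_add ha']
      simp
    calc a = a ^ (1 - p) * a ^ p := h2
      _ ≤ s ^ (1 - p) * a ^ p := by gcongr
      _ ≤ s + s ^ (1 - p) * a ^ p := by linarith

/-- for a Morrey function `f ∈ L^{p,λ}(ℝⁿ)` (with `0 < λ < n`) one has the uniform
bound `sup_x |T_t f(x)| ≤ C t^{(λ-n)/(pm)} ‖f‖_{L^{p,λ}}`, so `T_t f(x) → 0` as `t → ∞` for
every `x`; the limit function `σ_L(f)` vanishes identically. -/
theorem morrey_semigroup_limit_vanishes
    (n : ℕ) (hn : 1 ≤ n) (C₀ m ε : ℝ) (hC₀ : 0 < C₀) (hm : 0 < m) (hε : 0 < ε)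
    (K : ℝ → EuclideanSpace ℝ (Fin n) → EuclideanSpace ℝ (Fin n) → ℝ)
    (hKmeas : ∀ t : ℝ, 0 < t → Measurable (Function.uncurry (K t)))
    (hK : ∀ t : ℝ, 0 < t → ∀ x y : EuclideanSpace ℝ (Fin n),
      |K t x y| ≤ C₀ * t ^ (-(n : ℝ) / m) *
        (1 + ‖x - y‖ * t ^ (-(1 : ℝ) / m)) ^ (-((n : ℝ) + ε)))
    (p lam : ℝ) (hp : 1 ≤ p) (hlam0 : 0 < lam) (hlamn : lam < n) :
    ∃ C : ℝ, 0 < C ∧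
      ∀ (f : EuclideanSpace ℝ (Fin n) → ℂ) (N : ℝ), Measurable f → 0 ≤ N →
        (∀ (x : EuclideanSpace ℝ (Fin n)) (r : ℝ), 0 < r →
          IntegrableOn (fun y => ‖f y‖ ^ p) (ball x r)) →
        (∀ (x : EuclideanSpace ℝ (Fin n)) (r : ℝ), 0 < r →
          (∫ y in ball x r, ‖f y‖ ^ p) ≤ N ^ p * r ^ lam) →
        (∀ (t : ℝ), 0 < t → ∀ x : EuclideanSpace ℝ (Fin n),
          ‖∫ y, K t x y • f y‖ ≤ C * t ^ ((lam - n) / (p * m)) * N) ∧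
        (∀ x : EuclideanSpace ℝ (Fin n),
          Tendsto (fun t : ℝ => ∫ y, K t x y • f y) atTop (𝓝 0)) := by
  set d : ℝ := (n : ℝ) with hd
  have hn0 : 0 < d := hlam0.trans hlamn
  obtain ⟨D₁, hD₁, H₁⟩ := exists_lintegral_decay_mul_le
    (volume : Measure (EuclideanSpace ℝ (Fin n))) (κ := d) (β := d + ε)
    (by linarith) (by linarith)
  obtain ⟨D₂, hD₂, H₂⟩ := exists_lintegral_decay_mul_le
    (volume : Measure (EuclideanSpace ℝ (Fin n))) (κ := lam) (β := d + ε)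
    (by linarith) (by linarith)
  set V : ℝ := (volume (ball (0 : EuclideanSpace ℝ (Fin n)) 1)).toReal with hV
  have hV0 : 0 ≤ V := ENNReal.toReal_nonneg
  have hvol : ∀ (x : EuclideanSpace ℝ (Fin n)) (r : ℝ), 0 < r →
      ∫⁻ _ in ball x r, (1 : ENNReal) ≤ ENNReal.ofReal (V * r ^ d) := by
    intro x r hr
    rw [setLIntegral_one, Measure.addHaar_ball_of_pos _ _ hr, mul_comm, ENNReal.ofReal_mul hV0,
      hV, ENNReal.ofReal_toReal measure_ball_lt_top.ne, hd, Real.rpow_natCast,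
      finrank_euclideanSpace, Fintype.card_fin]
  set C : ℝ := C₀ * (D₁ * V + D₂) with hC
  have hCpos : 0 < C := by positivity
  refine ⟨C, hCpos, ?_⟩
  intro f N hf hN hint hmor
  have key : ∀ N' : ℝ, N < N' → ∀ t : ℝ, 0 < t → ∀ x : EuclideanSpace ℝ (Fin n),
      ‖∫ y, K t x y • f y‖ ≤ C * t ^ ((lam - d) / (p * m)) * N' := by
    intro N' hNN t ht x
    have hN' : 0 < N' := hN.trans_lt hNN
    set ρ : ℝ := t ^ (1 / m) with hρ
    have hρ0 : 0 < ρ := by positivity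
    set s : ℝ := ρ ^ ((lam - d) / p) * N' with hs
    have hs0 : 0 < s := by positivity
    have hst : t ^ ((lam - d) / (p * m)) * N' = s := by
      rw [hs, hρ, ← Real.rpow_mul ht.le]
      congr 2
      field_simp
    have hsp : s ^ p = ρ ^ (lam - d) * N' ^ p := by
      rw [hs, Real.mul_rpow (by positivity) hN'.le, ← Real.rpow_mul hρ0.le]
      congr 2
      field_simp
    have htn : t ^ (-d / m) = ρ ^ (-d) := by
      rw [hρ, ← Real.rpow_mul ht.le]
      congr 1
      ring
    have htm : t ^ (-(1 : ℝ) / m) = ρ⁻¹ := by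
      rw [hρ, neg_div, Real.rpow_neg ht.le]
    set w : EuclideanSpace ℝ (Fin n) → ℝ := fun y => (1 + dist x y * ρ⁻¹) ^ (-(d + ε)) with hw
    have hw0 : ∀ y, 0 ≤ w y := fun y => by positivity
    have hgm : Measurable fun y => ENNReal.ofReal (‖f y‖ ^ p) :=
      (hf.norm.pow_const p).ennreal_ofReal
    have hwm : Measurable fun y => ENNReal.ofReal (w y) := by
      have : Measurable fun y => 1 + dist x y * ρ⁻¹ := by fun_prop
      exact (this.pow_const _).ennreal_ofReal
    have h1 : ∫⁻ y, ENNReal.ofReal (w y) ≤ ENNReal.ofReal (D₁ * V * ρ ^ d) := by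
      simpa only [mul_one] using H₁ (fun _ => 1) x V ρ measurable_const hV0 hρ0 (hvol x)
    have h2 : ∫⁻ y, ENNReal.ofReal (w y) * ENNReal.ofReal (‖f y‖ ^ p) ≤
        ENNReal.ofReal (D₂ * N' ^ p * ρ ^ lam) := by
      refine H₂ _ x (N' ^ p) ρ hgm (by positivity) hρ0 fun r hr => ?_
      rw [← ofReal_integral_eq_lintegral_ofReal (hint x r hr)
        (Eventually.of_forall fun y => by positivity)]
      refine ENNReal.ofReal_le_ofReal ((hmor x r hr).trans ?_)
      gcongr
    have hpt : ∀ y, ‖K t x y • f y‖ₑ ≤ ENNReal.ofReal (C₀ * ρ ^ (-d)) *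
        (ENNReal.ofReal s * ENNReal.ofReal (w y) +
          ENNReal.ofReal (s ^ (1 - p)) *
            (ENNReal.ofReal (w y) * ENNReal.ofReal (‖f y‖ ^ p))) := by
      intro y
      have hwy := hw0 y
      rw [← ofReal_norm, ← ENNReal.ofReal_mul hwy, ← ENNReal.ofReal_mul hs0.le,
        ← ENNReal.ofReal_mul (by positivity), ← ENNReal.ofReal_add (by positivity) (by positivity),
        ← ENNReal.ofReal_mul (by positivity)]
      refine ENNReal.ofReal_le_ofReal ?_
      rw [norm_smul, Real.norm_eq_abs]
      have hKy := hK t ht x y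
      rw [htn, htm, ← dist_eq_norm] at hKy
      calc |K t x y| * ‖f y‖
          ≤ (C₀ * ρ ^ (-d) * w y) * (s + s ^ (1 - p) * ‖f y‖ ^ p) :=
            mul_le_mul hKy (le_add_rpow_mul_rpow (norm_nonneg _) hs0 hp) (norm_nonneg _)
              (by positivity)
        _ = _ := by ring
    have hfin : ENNReal.ofReal ‖∫ y, K t x y • f y‖ ≤ ENNReal.ofReal (C * s) := by
      rw [ofReal_norm]
      refine (enorm_integral_le_lintegral_enorm _).trans ((lintegral_mono hpt).trans ?_)
      rw [lintegral_const_mul _ (by fun_prop), lintegral_add_left (by fun_prop),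
        lintegral_const_mul _ hwm, lintegral_const_mul _ (by fun_prop)]
      calc _ ≤ ENNReal.ofReal (C₀ * ρ ^ (-d)) *
            (ENNReal.ofReal s * ENNReal.ofReal (D₁ * V * ρ ^ d) +
              ENNReal.ofReal (s ^ (1 - p)) * ENNReal.ofReal (D₂ * N' ^ p * ρ ^ lam)) := by
            gcongr
        _ = ENNReal.ofReal (C * s) := by
          rw [← ENNReal.ofReal_mul hs0.le, ← ENNReal.ofReal_mul (by positivity),
            ← ENNReal.ofReal_add (by positivity) (by positivity),
            ← ENNReal.ofReal_mul (by positivity)]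
          congr 1
          have e1 : ρ ^ (-d) * ρ ^ d = 1 := by
            rw [← Real.rpow_add hρ0]
            simp
          have e2 : s ^ (1 - p) * (ρ ^ (-d) * ρ ^ lam * N' ^ p) = s := by
            rw [← Real.rpow_add hρ0, neg_add_eq_sub, ← hsp, ← Real.rpow_add hs0]
            simp
          rw [hC]
          linear_combination (C₀ * s * D₁ * V) * e1 + (C₀ * D₂) * e2
    rw [mul_assoc, hst]
    exact (ENNReal.ofReal_le_ofReal_iff (by positivity)).1 hfin
  have hbound : ∀ t : ℝ, 0 < t → ∀ x : EuclideanSpace ℝ (Fin n),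
      ‖∫ y, K t x y • f y‖ ≤ C * t ^ ((lam - d) / (p * m)) * N := by
    intro t ht x
    have hlim : Tendsto (fun N' : ℝ => C * t ^ ((lam - d) / (p * m)) * N') (𝓝[>] N)
        (𝓝 (C * t ^ ((lam - d) / (p * m)) * N)) :=
      (tendsto_id.mono_left nhdsWithin_le_nhds).const_mul _
    refine ge_of_tendsto hlim ?_
    filter_upwards [self_mem_nhdsWithin] with N' hN'
    exact key N' hN' t ht x
  refine ⟨hbound, fun x => ?_⟩
  have hlim : Tendsto (fun t : ℝ => C * t ^ ((lam - d) / (p * m)) * N) atTop (𝓝 0) := by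
    have h := tendsto_rpow_neg_atTop (y := (d - lam) / (p * m))
      (div_pos (by linarith) (by positivity))
    rw [← neg_div, neg_sub] at h
    simpa using (h.const_mul C).mul_const N
  refine squeeze_zero_norm' ?_ hlim
  filter_upwards [eventually_gt_atTop 0] with t ht
  exact hbound t ht x
end

section
/- Let n ≥ 1, 0 < λ < n and C₀ > 0. Let t > 0 and let Q : ℝⁿ × ℝⁿ → ℝ be measurable with |Q(x,y)| ≤ C₀ t (t + |x−y|)^{-(n+1)} for all x, y. Let B = B(x_B, r_B) be a ball in ℝⁿ, let k ≥ 1 be an integer, and let f ∈ L^{2,λ}(ℝⁿ). Then there is a constant C, depending only on n, λ, C₀, such that for every x ∈ B, |∫_{2^{k+1}B ∖ 2^k B} Q(x,y) f(y) dy| ≤ C t (2^k r_B)^{-(1 + (n−λ)/2)} ‖f‖_{L^{2,λ}}, where 2^j B := B(x_B, 2^j r_B). -/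
open MeasureTheory Metric Filter Topology

/-- Cauchy–Schwarz against the constant function `1` on a set of finite measure. -/
theorem setIntegral_norm_le_sqrt_mul_sqrt {α E : Type*} [MeasurableSpace α] {μ : Measure α}
    [NormedAddCommGroup E] {s : Set α} {f : α → E} (hs : μ s ≠ ⊤)
    (hf : MemLp f 2 (μ.restrict s)) :
    ∫ y in s, ‖f y‖ ∂μ ≤ √(∫ y in s, ‖f y‖ ^ 2 ∂μ) * √(μ.real s) := by
  have : IsFiniteMeasure (μ.restrict s) := isFiniteMeasure_restrict.2 hs
  have h := integral_mul_norm_le_Lp_mul_Lq (μ := μ.restrict s) (f := fun y => ‖f y‖)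
    (g := fun _ => (1 : ℝ))
    Real.HolderConjugate.two_two (by simpa using hf.norm) (by simpa using memLp_const (1 : ℝ))
  simpa [Real.sqrt_eq_rpow, measureReal_def] using h

/-- Average growth of a Morrey function: the `L¹` norm over a ball of radius `r`. -/
theorem setIntegral_norm_ball_le_of_morrey {n : ℕ} {E : Type*} [NormedAddCommGroup E]
    {f : EuclideanSpace ℝ (Fin n) → E} {x : EuclideanSpace ℝ (Fin n)} {r lam N : ℝ}
    (hr : 0 < r) (hN : 0 ≤ N) (hf : MemLp f 2 (volume.restrict (ball x r)))
    (hle : ∫ y in ball x r, ‖f y‖ ^ 2 ≤ N ^ 2 * r ^ lam) :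
    ∫ y in ball x r, ‖f y‖ ≤
      √(volume.real (ball (0 : EuclideanSpace ℝ (Fin n)) 1)) * r ^ ((n + lam) / 2) * N := by
  have hvol : volume.real (ball x r) =
      r ^ (n : ℝ) * volume.real (ball (0 : EuclideanSpace ℝ (Fin n)) 1) := by
    rw [measureReal_def, Measure.addHaar_ball_of_pos _ _ hr, ENNReal.toReal_mul,
      ENNReal.toReal_ofReal (by positivity), finrank_euclideanSpace_fin, Real.rpow_natCast,
      measureReal_def]
  have hsqrt (a : ℝ) : √(r ^ a) = r ^ (a / 2) := by
    rw [Real.sqrt_eq_rpow, ← Real.rpow_mul hr.le, mul_one_div]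
  calc ∫ y in ball x r, ‖f y‖
      ≤ √(∫ y in ball x r, ‖f y‖ ^ 2) * √(volume.real (ball x r)) :=
        setIntegral_norm_le_sqrt_mul_sqrt measure_ball_lt_top.ne hf
    _ ≤ √(N ^ 2 * r ^ lam) * √(volume.real (ball x r)) := by gcongr
    _ = _ := by
        rw [hvol, Real.sqrt_mul (sq_nonneg N), Real.sqrt_sq hN, Real.sqrt_mul (by positivity),
          hsqrt, hsqrt, add_div, Real.rpow_add hr]
        ring

/-- annulus estimate for a kernel with Poisson-type decay acting on a Morrey
function: for `x ∈ B(x_B, r_B)` and `k ≥ 1`,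
`|∫_{2^{k+1}B ∖ 2^k B} Q(x,y) f(y) dy| ≤ C t (2^k r_B)^{-(1+(n-λ)/2)} ‖f‖_{L^{2,λ}}`. -/
theorem poisson_annulus_morrey_estimate
    (n : ℕ) (hn : 1 ≤ n) (lam C₀ : ℝ) (hlam0 : 0 < lam) (hlamn : lam < n) (hC₀ : 0 < C₀) :
    ∃ C : ℝ, 0 < C ∧
      ∀ (t : ℝ), 0 < t →
      ∀ (Q : EuclideanSpace ℝ (Fin n) → EuclideanSpace ℝ (Fin n) → ℝ),
        Measurable (Function.uncurry Q) →
        (∀ x y : EuclideanSpace ℝ (Fin n),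
          |Q x y| ≤ C₀ * t * (t + ‖x - y‖) ^ (-((n : ℝ) + 1))) →
      ∀ (f : EuclideanSpace ℝ (Fin n) → ℂ) (N : ℝ), Measurable f → 0 ≤ N →
        (∀ (x : EuclideanSpace ℝ (Fin n)) (r : ℝ), 0 < r →
          IntegrableOn (fun y => ‖f y‖ ^ 2) (ball x r) ∧
          (∫ y in ball x r, ‖f y‖ ^ 2) ≤ N ^ 2 * r ^ lam) →
      ∀ (xB : EuclideanSpace ℝ (Fin n)) (rB : ℝ), 0 < rB → ∀ k : ℕ, 1 ≤ k →
      ∀ x ∈ ball xB rB,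
        ‖∫ y in ball xB (2 ^ (k + 1) * rB) \ ball xB (2 ^ k * rB), Q x y • f y‖ ≤
          C * t * ((2 : ℝ) ^ k * rB) ^ (-(1 + ((n : ℝ) - lam) / 2)) * N := by
  set V := volume.real (ball (0 : EuclideanSpace ℝ (Fin n)) 1) with hV
  have hVpos : 0 < V :=
    ENNReal.toReal_pos (measure_ball_pos _ _ one_pos).ne' measure_ball_lt_top.ne
  refine ⟨C₀ * (2 : ℝ) ^ ((n : ℝ) + 1) * (√V * (2 : ℝ) ^ (((n : ℝ) + lam) / 2)), by positivity, ?_⟩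
  intro t ht Q _ hQ f N hf hN hM xB rB hrB k hk x hx
  set R : ℝ := 2 ^ k * rB with hR
  have hRpos : 0 < R := by positivity
  have h2R : (2 : ℝ) ^ (k + 1) * rB = 2 * R := by rw [hR]; ring
  have hrR : 2 * rB ≤ R := by
    have : (2 : ℝ) ^ 1 ≤ 2 ^ k := pow_le_pow_right₀ one_le_two hk
    rw [hR]; nlinarith
  rw [h2R]
  obtain ⟨hint, hle⟩ := hM xB (2 * R) (by positivity)
  have hL2 : MemLp f 2 (volume.restrict (ball xB (2 * R))) :=
    (memLp_two_iff_integrable_sq_norm hf.aestronglyMeasurable).2 hint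
  have : IsFiniteMeasure (volume.restrict (ball xB (2 * R))) :=
    isFiniteMeasure_restrict.2 measure_ball_lt_top.ne
  have hL1 : IntegrableOn (fun y => ‖f y‖) (ball xB (2 * R)) :=
    (hL2.integrable (by norm_num)).norm
  set M : ℝ := C₀ * t * (R / 2) ^ (-((n : ℝ) + 1)) with hMdef
  have hMpos : 0 < M := by positivity
  have hker : ∀ y ∈ ball xB (2 * R) \ ball xB R, ‖Q x y • f y‖ ≤ M * ‖f y‖ := by
    intro y hy
    have hdist : R / 2 ≤ t + ‖x - y‖ := by
      have hy2 : R ≤ dist y xB := not_lt.1 hy.2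
      have hx' : dist x xB < rB := hx
      have := dist_triangle y x xB
      rw [dist_comm y x, dist_eq_norm x y] at this
      linarith
    rw [norm_smul, Real.norm_eq_abs]
    gcongr
    refine (hQ x y).trans ?_
    rw [hMdef]
    gcongr C₀ * t * ?_
    exact Real.rpow_le_rpow_of_nonpos (by positivity) hdist (by linarith [n.cast_nonneg (α := ℝ)])
  calc ‖∫ y in ball xB (2 * R) \ ball xB R, Q x y • f y‖
      ≤ ∫ y in ball xB (2 * R) \ ball xB R, M * ‖f y‖ :=
        norm_integral_le_of_norm_le ((hL1.mono_set Set.sdiff_subset).const_mul M)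
          (ae_restrict_of_forall_mem (measurableSet_ball.diff measurableSet_ball) hker)
    _ ≤ ∫ y in ball xB (2 * R), M * ‖f y‖ :=
        setIntegral_mono_set (hL1.const_mul M) (ae_of_all _ fun y => by positivity)
          Set.sdiff_subset.eventuallyLE
    _ = M * ∫ y in ball xB (2 * R), ‖f y‖ := integral_const_mul _ _
    _ ≤ M * (√V * (2 * R) ^ ((n + lam) / 2) * N) := by
        gcongr
        exact setIntegral_norm_ball_le_of_morrey (by positivity) hN hL2 hle
    _ = _ := by
        have hexp : R ^ (-(1 + ((n : ℝ) - lam) / 2)) =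
            R ^ (-((n : ℝ) + 1)) * R ^ (((n : ℝ) + lam) / 2) := by
          rw [← Real.rpow_add hRpos]
          congr 1
          ring
        rw [hexp, hMdef, Real.div_rpow hRpos.le zero_le_two, Real.rpow_neg zero_le_two,
          Real.mul_rpow zero_le_two hRpos.le, div_inv_eq_mul]
        ring
end

section
/- Let n ≥ 1, 0 < λ < n and C₀ > 0. Let t > 0 and let P : ℝⁿ × ℝⁿ → ℝ be measurable with 0 ≤ P(x,y) ≤ C₀ t (t² + |x−y|²)^{-(n+1)/2} for all x, y. Then there is a constant C, depending only on n, λ, C₀, such that for every f ∈ L^{2,λ}(ℝⁿ), every x ∈ ℝⁿ and every integer ℓ ≥ 1, ∫_{ℝⁿ ∖ B(x, 2^ℓ t)} P(x,y) |f(y)| dy ≤ C 2^{-ℓ(1 + (n−λ)/2)} t^{(λ−n)/2} ‖f‖_{L^{2,λ}}. -/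
open MeasureTheory Metric Filter Topology

/-- A Morrey bound on the square of `f` over a ball controls its `L¹` norm over that ball. -/
lemma lintegral_norm_ball_le_of_morrey {n : ℕ} {lam N r : ℝ} (hN : 0 < N)
    (hr : 0 < r) {f : EuclideanSpace ℝ (Fin n) → ℂ}
    {x : EuclideanSpace ℝ (Fin n)}
    (hint : IntegrableOn (fun y => ‖f y‖ ^ 2) (ball x r))
    (hle : (∫ y in ball x r, ‖f y‖ ^ 2) ≤ N ^ 2 * r ^ lam) :
    (∫⁻ y in ball x r, ENNReal.ofReal ‖f y‖) ≤
      ENNReal.ofReal ((volume.real (ball (0 : EuclideanSpace ℝ (Fin n)) 1) + 1) / 2 *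
        (N * r ^ (((n : ℝ) + lam) / 2))) := by
  set v := volume.real (ball (0 : EuclideanSpace ℝ (Fin n)) 1)
  set a := N * r ^ ((lam - n) / 2) with ha
  have ha0 : 0 < a := by positivity
  have hvol : volume.real (ball x r) = r ^ (n : ℝ) * v := by
    rw [measureReal_def, Measure.addHaar_ball_of_pos _ _ hr, ENNReal.toReal_mul,
      ENNReal.toReal_ofReal (by positivity), ← measureReal_def, finrank_euclideanSpace_fin, Real.rpow_natCast]
  have hconst : IntegrableOn (fun _ : EuclideanSpace ℝ (Fin n) => a / 2) (ball x r) :=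
    integrableOn_const measure_ball_lt_top.ne
  have hg : IntegrableOn (fun y => a / 2 + (2 * a)⁻¹ * ‖f y‖ ^ 2) (ball x r) :=
    hconst.add (hint.const_mul _)
  have hpt : ∀ y, ‖f y‖ ≤ a / 2 + (2 * a)⁻¹ * ‖f y‖ ^ 2 := by
    intro y
    have h : a / 2 + (2 * a)⁻¹ * ‖f y‖ ^ 2 - ‖f y‖ = (2 * a)⁻¹ * (a - ‖f y‖) ^ 2 := by
      field_simp
      ring
    have : 0 ≤ (2 * a)⁻¹ * (a - ‖f y‖) ^ 2 := by positivity
    linarith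
  refine (lintegral_mono fun y => ENNReal.ofReal_le_ofReal (hpt y)).trans ?_
  rw [← ofReal_integral_eq_lintegral_ofReal hg
    (Eventually.of_forall fun y => (norm_nonneg _).trans (hpt y))]
  apply ENNReal.ofReal_le_ofReal
  rw [integral_add hconst (hint.const_mul _), integral_const_mul, setIntegral_const, hvol,
    smul_eq_mul]
  have e1 : a * r ^ (n : ℝ) = N * r ^ (((n : ℝ) + lam) / 2) := by
    rw [ha, mul_assoc, ← Real.rpow_add hr]
    ring_nf
  have e2 : a⁻¹ * (N ^ 2 * r ^ lam) = N * r ^ (((n : ℝ) + lam) / 2) := by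
    have : r ^ lam = r ^ ((lam - n) / 2) * r ^ (((n : ℝ) + lam) / 2) := by
      rw [← Real.rpow_add hr]
      ring_nf
    rw [ha, this]
    field_simp
  calc r ^ (n : ℝ) * v * (a / 2) + (2 * a)⁻¹ * ∫ y in ball x r, ‖f y‖ ^ 2
      ≤ r ^ (n : ℝ) * v * (a / 2) + (2 * a)⁻¹ * (N ^ 2 * r ^ lam) := by gcongr
    _ = v / 2 * (a * r ^ (n : ℝ)) + 1 / 2 * (a⁻¹ * (N ^ 2 * r ^ lam)) := by
      rw [mul_inv]
      ring
    _ = _ := by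
      rw [e1, e2]
      ring

/-- The complement of a ball is covered by dyadic shells. -/
lemma compl_ball_subset_iUnion_dyadic_shells {E : Type*} [PseudoMetricSpace E] (x : E) {R : ℝ}
    (hR : 0 < R) :
    (ball x R)ᶜ ⊆ ⋃ k : ℕ, ball x (2 ^ (k + 1) * R) \ ball x (2 ^ k * R) := by
  intro y hy
  have hy' : R ≤ dist y x := by simpa using hy
  obtain ⟨k, h1, h2⟩ := exists_nat_pow_near (x := dist y x / R) (y := (2 : ℝ))
    ((one_le_div hR).2 hy') one_lt_two
  refine Set.mem_iUnion.2 ⟨k, ?_, ?_⟩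
  · exact mem_ball.2 ((div_lt_iff₀ hR).1 h2)
  · simpa using (le_div_iff₀ hR).1 h1

/-- The Poisson kernel profile is bounded by its decay outside a ball. -/
lemma poisson_profile_le {s t ρ d : ℝ} (hs : 0 ≤ s) (hρ : 0 < ρ) (hd : ρ ≤ d) :
    (t ^ 2 + d ^ 2) ^ (-s / 2) ≤ ρ ^ (-s) := by
  calc (t ^ 2 + d ^ 2) ^ (-s / 2) ≤ (ρ ^ 2) ^ (-s / 2) := by
        apply Real.rpow_le_rpow_of_nonpos (by positivity) _ (by linarith)
        nlinarith [sq_nonneg t]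
    _ = ρ ^ (-s) := by
        rw [← Real.rpow_natCast ρ 2, ← Real.rpow_mul hρ.le]
        congr 1
        push_cast
        ring

/-- tail estimate for a Poisson-type kernel acting on a Morrey function: for
every `x` and every integer `ℓ ≥ 1`,
`∫_{ℝⁿ ∖ B(x, 2^ℓ t)} P(x,y) |f(y)| dy ≤ C 2^{-ℓ(1+(n-λ)/2)} t^{(λ-n)/2} ‖f‖_{L^{2,λ}}`. -/
theorem poisson_tail_morrey_estimate
    (n : ℕ) (hn : 1 ≤ n) (lam C₀ : ℝ) (hlam0 : 0 < lam) (hlamn : lam < n) (hC₀ : 0 < C₀) :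
    ∃ C : ℝ, 0 < C ∧
      ∀ (t : ℝ), 0 < t →
      ∀ (P : EuclideanSpace ℝ (Fin n) → EuclideanSpace ℝ (Fin n) → ℝ),
        Measurable (Function.uncurry P) →
        (∀ x y : EuclideanSpace ℝ (Fin n), 0 ≤ P x y) →
        (∀ x y : EuclideanSpace ℝ (Fin n),
          P x y ≤ C₀ * t * (t ^ 2 + ‖x - y‖ ^ 2) ^ (-((n : ℝ) + 1) / 2)) →
      ∀ (f : EuclideanSpace ℝ (Fin n) → ℂ) (N : ℝ), Measurable f → 0 ≤ N →
        (∀ (x : EuclideanSpace ℝ (Fin n)) (r : ℝ), 0 < r →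
          IntegrableOn (fun y => ‖f y‖ ^ 2) (ball x r) ∧
          (∫ y in ball x r, ‖f y‖ ^ 2) ≤ N ^ 2 * r ^ lam) →
      ∀ (x : EuclideanSpace ℝ (Fin n)) (ℓ : ℕ), 1 ≤ ℓ →
        (∫ y in (ball x ((2 : ℝ) ^ ℓ * t))ᶜ, P x y * ‖f y‖) ≤
          C * (2 : ℝ) ^ (-(ℓ : ℝ) * (1 + ((n : ℝ) - lam) / 2)) *
            t ^ ((lam - (n : ℝ)) / 2) * N := by
  set v := volume.real (ball (0 : EuclideanSpace ℝ (Fin n)) 1)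
  have hv : 0 ≤ v := measureReal_nonneg
  set β : ℝ := 1 + ((n : ℝ) - lam) / 2 with hβ
  have hβ0 : 0 < β := by
    rw [hβ]
    linarith
  set q : ℝ := (2 : ℝ) ^ (-β) with hq
  have hq0 : 0 < q := by positivity
  have hq1 : q < 1 := Real.rpow_lt_one_of_one_lt_of_neg one_lt_two (by linarith)
  have h1q : 0 < 1 - q := by linarith
  set D : ℝ := C₀ * ((v + 1) / 2) * (2 : ℝ) ^ (((n : ℝ) + lam) / 2) with hD
  have hD0 : 0 < D := by positivity
  refine ⟨D * (1 - q)⁻¹, by positivity, ?_⟩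
  intro t ht P hPm hP0 hP f N hf hN hmorrey x ℓ _
  set R : ℝ := (2 : ℝ) ^ ℓ * t with hR
  have hR0 : 0 < R := by positivity
  have hscale : t * R ^ (-β) = (2 : ℝ) ^ (-(ℓ : ℝ) * β) * t ^ ((lam - (n : ℝ)) / 2) := by
    rw [hR, Real.mul_rpow (by positivity) ht.le, ← Real.rpow_natCast 2 ℓ,
      ← Real.rpow_mul zero_le_two, mul_left_comm]
    congr 1
    · ring_nf
    · nth_rw 1 [← Real.rpow_one t]
      rw [← Real.rpow_add ht]
      congr 1
      rw [hβ]
      ring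
  have key : ∀ M : ℝ, 0 < M → N ≤ M →
      (∫ y in (ball x R)ᶜ, P x y * ‖f y‖) ≤ D * (1 - q)⁻¹ * (t * R ^ (-β)) * M := by
    intro M hM hNM
    have hshell : ∀ k : ℕ,
        (∫⁻ y in ball x (2 ^ (k + 1) * R) \ ball x (2 ^ k * R),
          ENNReal.ofReal (P x y * ‖f y‖)) ≤
        ENNReal.ofReal (D * (t * R ^ (-β)) * M * q ^ k) := by
      intro k
      set ρ : ℝ := 2 ^ k * R with hρ
      have hρ0 : 0 < ρ := by positivity
      have hρ2 : 2 ^ (k + 1) * R = 2 * ρ := by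
        rw [hρ]
        ring
      rw [hρ2]
      set c : ℝ := C₀ * t * ρ ^ (-((n : ℝ) + 1)) with hc
      have hc0 : 0 ≤ c := by positivity
      have hball := lintegral_norm_ball_le_of_morrey (lam := lam) hM
        (show 0 < 2 * ρ by positivity) (f := f) (hmorrey x (2 * ρ) (by positivity)).1
        ((hmorrey x (2 * ρ) (by positivity)).2.trans (by gcongr))
      calc (∫⁻ y in ball x (2 * ρ) \ ball x ρ, ENNReal.ofReal (P x y * ‖f y‖))
          ≤ ∫⁻ y in ball x (2 * ρ) \ ball x ρ, ENNReal.ofReal c * ENNReal.ofReal ‖f y‖ := by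
            refine setLIntegral_mono' (measurableSet_ball.diff measurableSet_ball) ?_
            intro y hy
            rw [← ENNReal.ofReal_mul hc0]
            apply ENNReal.ofReal_le_ofReal
            refine mul_le_mul_of_nonneg_right ((hP x y).trans ?_) (norm_nonneg _)
            refine mul_le_mul_of_nonneg_left ?_ (by positivity)
            refine poisson_profile_le (by positivity) hρ0 ?_
            have := hy.2
            rwa [mem_ball, not_lt, dist_comm, dist_eq_norm] at this
        _ ≤ ∫⁻ y in ball x (2 * ρ), ENNReal.ofReal c * ENNReal.ofReal ‖f y‖ :=
            lintegral_mono_set Set.sdiff_subset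
        _ = ENNReal.ofReal c * ∫⁻ y in ball x (2 * ρ), ENNReal.ofReal ‖f y‖ :=
            lintegral_const_mul _ hf.norm.ennreal_ofReal
        _ ≤ ENNReal.ofReal c * ENNReal.ofReal ((v + 1) / 2 *
              (M * (2 * ρ) ^ (((n : ℝ) + lam) / 2))) := by gcongr
        _ = ENNReal.ofReal (D * (t * R ^ (-β)) * M * q ^ k) := by
            rw [← ENNReal.ofReal_mul hc0]
            congr 1
            have e1 : ρ ^ (-((n : ℝ) + 1)) * ρ ^ (((n : ℝ) + lam) / 2) = q ^ k * R ^ (-β) := by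
              rw [← Real.rpow_add hρ0, hq, ← Real.rpow_natCast ((2 : ℝ) ^ (-β)) k,
                ← Real.rpow_mul zero_le_two, mul_comm (-β), Real.rpow_mul zero_le_two,
                Real.rpow_natCast,
                ← Real.mul_rpow (by positivity) hR0.le, ← hρ, hβ]
              congr 1
              ring
            rw [Real.mul_rpow zero_le_two hρ0.le, hc, hD]
            linear_combination (C₀ * ((v + 1) / 2) * (2 : ℝ) ^ (((n : ℝ) + lam) / 2) * t * M) * e1
    have hsum : HasSum (fun k : ℕ => D * (t * R ^ (-β)) * M * q ^ k)
        (D * (t * R ^ (-β)) * M * (1 - q)⁻¹) :=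
      (hasSum_geometric_of_lt_one hq0.le hq1).mul_left _
    have hlin : (∫⁻ y in (ball x R)ᶜ, ENNReal.ofReal (P x y * ‖f y‖)) ≤
        ENNReal.ofReal (D * (1 - q)⁻¹ * (t * R ^ (-β)) * M) := by
      calc _ ≤ ∫⁻ y in ⋃ k : ℕ, ball x (2 ^ (k + 1) * R) \ ball x (2 ^ k * R),
              ENNReal.ofReal (P x y * ‖f y‖) :=
            lintegral_mono_set (compl_ball_subset_iUnion_dyadic_shells x hR0)
        _ ≤ ∑' k : ℕ, ∫⁻ y in ball x (2 ^ (k + 1) * R) \ ball x (2 ^ k * R),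
              ENNReal.ofReal (P x y * ‖f y‖) := lintegral_iUnion_le _ _
        _ ≤ ∑' k : ℕ, ENNReal.ofReal (D * (t * R ^ (-β)) * M * q ^ k) :=
            ENNReal.tsum_le_tsum hshell
        _ = ENNReal.ofReal (D * (1 - q)⁻¹ * (t * R ^ (-β)) * M) := by
            rw [← ENNReal.ofReal_tsum_of_nonneg (fun k => by positivity) hsum.summable,
              hsum.tsum_eq]
            congr 1
            ring
    have hmeas : Measurable fun y => P x y * ‖f y‖ :=
      (hPm.comp measurable_prodMk_left).mul hf.norm
    rw [integral_eq_lintegral_of_nonneg_ae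
      (Eventually.of_forall fun y => mul_nonneg (hP0 x y) (norm_nonneg _))
      hmeas.aestronglyMeasurable]
    exact ENNReal.toReal_le_of_le_ofReal (by positivity) hlin
  have hK : 0 < D * (1 - q)⁻¹ * (t * R ^ (-β)) := by positivity
  rw [mul_assoc (D * (1 - q)⁻¹), ← hscale]
  refine le_of_forall_pos_le_add fun ε hε => ?_
  have h := key (N + ε / (D * (1 - q)⁻¹ * (t * R ^ (-β)))) (by positivity)
    (le_add_of_nonneg_right (by positivity))
  rwa [mul_add, mul_div_cancel₀ _ hK.ne'] at h
end
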